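/- Let n ≥ 2 be an integer and p a prime. Then there exist constants c₁, c₂, c₃, c₄ > 0 depending only on n and p such that for all sufficiently large Q there are at least c₁ Q^{(n+1)/3} elements α ∈ ℤ_p with the following property: α is a root of an irreducible polynomial P ∈ ℤ[X] of degree n with c₂ Q ≤ H(P) ≤ c₃ Q, and P has another root β ≠ α in the algebraic closure of ℚ_p (a conjugate of α) satisfying 0 < |α − β|_p ≤ c₄ Q^{−(n+1)/3}. -/

import Mathlib

open Polynomial

/-- The height of an integer polynomial: the maximum of the absolute values of its
coefficients. -/
def polyHeight (P : Polynomial ℤ) : ℕ :=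
  (Finset.range (P.natDegree + 1)).sup fun i => (P.coeff i).natAbs

/-- The naturals below `p ^ K` in the residue class `a` modulo `p ^ s`. -/
def residueBall (p K s a : ℕ) : Finset ℕ := (Finset.range (p ^ K)).filter (· % p ^ s = a)

/-- The point `x` admits a chain of elements of `S` on which `ψ` is below `1`, such that `ψ` is at
least `ε` on all elements of `S` comparable with the whole chain. -/
def FlagMarked {α : Type*} [PartialOrder α] (ψ : α → ℕ → ℝ) (S : Set α) (ε : ℝ) (x : ℕ) : Prop :=
  ∃ F ⊆ S, IsChain (· ≤ ·) F ∧ (∀ V ∈ F, ψ V x < 1) ∧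
    ∀ W ∈ S, (∀ V ∈ F, V ≤ W ∨ W ≤ V) → ε ≤ ψ W x

theorem mem_residueBall {p K s a x : ℕ} :
    x ∈ residueBall p K s a ↔ x < p ^ K ∧ x % p ^ s = a := by
  simp [residueBall]

theorem card_residueBall {p K s a : ℕ} (hp : 0 < p) (hs : s ≤ K) (ha : a < p ^ s) :
    (residueBall p K s a).card = p ^ (K - s) := by
  have hps : 0 < p ^ s := pow_pos hp s
  have : residueBall p K s a = (Finset.range (p ^ (K - s))).image (fun i => a + p ^ s * i) := by
    ext x
    simp only [mem_residueBall, Finset.mem_image, Finset.mem_range]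
    have hK : p ^ K = p ^ s * p ^ (K - s) := by rw [← pow_add, Nat.add_sub_cancel' hs]
    constructor
    · rintro ⟨hx, hxa⟩
      refine ⟨x / p ^ s, ?_, ?_⟩
      · rw [Nat.div_lt_iff_lt_mul hps, mul_comm, ← hK]; exact hx
      · rw [← hxa]; exact Nat.mod_add_div x _
    · rintro ⟨i, hi, rfl⟩
      refine ⟨?_, ?_⟩
      · rw [hK]
        calc a + p ^ s * i < p ^ s * (i + 1) := by rw [mul_add]; omega
          _ ≤ _ := Nat.mul_le_mul_left _ hi
      · rw [Nat.add_mul_mod_self_left, Nat.mod_eq_of_lt ha]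
  rw [this, Finset.card_image_of_injective, Finset.card_range]
  intro i j hij
  exact Nat.eq_of_mul_eq_mul_left hps (Nat.add_left_cancel hij)

/-- Decomposition of a residue class modulo `p ^ s` into classes modulo `p ^ (s + 1)`. -/
theorem card_filter_residueBall_eq_sum {p K s a : ℕ} (hp : 0 < p) (P : ℕ → Prop) [DecidablePred P] :
    ((residueBall p K s a).filter P).card =
      ∑ c ∈ residueBall p (s + 1) s a, ((residueBall p K (s + 1) c).filter P).card := by
  rw [Finset.card_eq_sum_card_fiberwise (f := (· % p ^ (s + 1))) (t := residueBall p (s + 1) s a)]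
  · refine Finset.sum_congr rfl fun c hc => congrArg _ ?_
    ext x
    simp only [Finset.mem_filter, mem_residueBall] at hc ⊢
    constructor
    · tauto
    · rintro ⟨⟨h1, h2⟩, h3⟩
      refine ⟨⟨⟨h1, ?_⟩, h3⟩, h2⟩
      rw [← hc.2, ← h2, Nat.mod_mod_of_dvd _ (pow_dvd_pow p s.le_succ)]
  · intro x hx
    simp only [Finset.coe_filter, Set.mem_ofPred_eq, mem_residueBall, SetLike.mem_coe] at hx ⊢
    refine ⟨Nat.mod_lt _ (pow_pos hp _), ?_⟩
    rw [Nat.mod_mod_of_dvd _ (pow_dvd_pow p s.le_succ), hx.1.2]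

theorem FlagMarked.insert {α : Type*} [PartialOrder α] {ψ : α → ℕ → ℝ} {S : Set α} {ε : ℝ} {x : ℕ}
    {V : α} (hV : V ∈ S) (h : FlagMarked ψ {W ∈ S | W ≠ V ∧ (V ≤ W ∨ W ≤ V)} ε x)
    (h1 : ψ V x < 1) (h2 : ε ≤ ψ V x) : FlagMarked ψ S ε x := by
  obtain ⟨F, hFS, hF, hF1, hFW⟩ := h
  refine ⟨Insert.insert V F, ?_, ?_, ?_, ?_⟩
  · rintro W (rfl | hW)
    exacts [hV, (hFS hW).1]
  · exact hF.insert fun W hW _ => (hFS hW).2.2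
  · rintro W (rfl | hW)
    exacts [h1, hF1 W hW]
  · intro W hW hc
    rcases eq_or_ne W V with rfl | hne
    · exact h2
    · exact hFW W ⟨hW, hne, hc V (Set.mem_insert _ _)⟩ fun U hU => hc U (Set.mem_insert_of_mem _ hU)

open Classical in
/-- A discrete form of the Kleinbock–Margulis covering argument. -/
theorem card_not_flagMarked_le {α : Type*} [PartialOrder α] (ψ : α → ℕ → ℝ) {p K k₀ : ℕ}
    (hp : 0 < p) {η θ : ℝ} (hη0 : 0 < η) (hη1 : η ≤ 1) (hθ : 0 ≤ θ)
    (hconst : ∀ V x y, x % p ^ k₀ = y % p ^ k₀ → ψ V x = ψ V y)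
    (hgood : ∀ V s a x₀, s ≤ k₀ → x₀ % p ^ s = a →
      (((residueBall p K s a).filter (ψ V · < η * ψ V x₀)).card : ℝ) ≤
        θ * (residueBall p K s a).card)
    (hstep : ∀ V s c x₀, s < k₀ → c < p ^ (s + 1) → x₀ % p ^ s = c % p ^ s →
      ∃ x₁, x₁ % p ^ (s + 1) = c ∧ η * ψ V x₀ ≤ ψ V x₁) (d : ℕ) :
    ∀ S : Set α, (∀ F : Finset α, ↑F ⊆ S → IsChain (· ≤ ·) (F : Set α) → F.card ≤ d) →
      ∀ ρ : ℝ, 0 < ρ → ρ ≤ 1 → ∀ s a, s ≤ k₀ → (∀ V ∈ S, ∃ x₀, x₀ % p ^ s = a ∧ ρ ≤ ψ V x₀) →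
      (((residueBall p K s a).filter fun x => ¬ FlagMarked ψ S (η ^ (d + 1) * ρ) x).card : ℝ) ≤
        d * θ * (residueBall p K s a).card := by
  induction d with
  | zero =>
    intro S hS ρ hρ hρ1 s a hs h
    have hSe : S = ∅ := by
      by_contra hne
      obtain ⟨V, hV⟩ := Set.nonempty_iff_ne_empty.mpr hne
      simpa using hS {V} (by simpa using hV) (by simp)
    rw [Finset.card_eq_zero.mpr]
    · simp
    · refine Finset.filter_eq_empty_iff.mpr fun x _ => not_not.mpr ⟨∅, ?_⟩
      simp [hSe]
  | succ d ih =>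
    intro S hS ρ hρ hρ1 s a hs
    induction hr : k₀ - s generalizing s a with
    | zero =>
      intro h
      rw [Finset.card_eq_zero.mpr]
      · simp only [Nat.cast_zero]; positivity
      · refine Finset.filter_eq_empty_iff.mpr fun x hx => not_not.mpr ⟨∅, by simp, by simp, by simp, ?_⟩
        intro W hW _
        obtain ⟨x₀, hx₀, hρx⟩ := h W hW
        have hsk : s = k₀ := by omega
        subst hsk
        rw [hconst W x x₀ (by rw [hx₀, (mem_residueBall.mp hx).2])]
        exact (mul_le_of_le_one_left hρ.le (pow_le_one₀ hη0.le hη1)).trans hρx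
    | succ r ihr =>
      intro h
      have hcard := card_filter_residueBall_eq_sum (K := K) (s := s) (a := a) hp (fun _ => True)
      simp only [Finset.filter_true] at hcard
      rw [card_filter_residueBall_eq_sum hp, hcard, Nat.cast_sum, Nat.cast_sum, Finset.mul_sum]
      refine Finset.sum_le_sum fun c hc => ?_
      obtain ⟨hc1, hc2⟩ := mem_residueBall.mp hc
      by_cases hall : ∀ V ∈ S, ∃ x₀, x₀ % p ^ (s + 1) = c ∧ ρ ≤ ψ V x₀
      · exact ihr (s + 1) c (by omega) (by omega) hall
      push Not at hall
      obtain ⟨V, hV, hVlt⟩ := hall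
      have key := ih {W ∈ S | W ≠ V ∧ (V ≤ W ∨ W ≤ V)} ?_ (η * ρ) (by positivity)
        (mul_le_one₀ hη1 hρ.le hρ1) (s + 1) c (by omega) ?_
      · obtain ⟨x₀, hx₀, hρx⟩ := h V hV
        obtain ⟨x₁, hx₁, hηx⟩ := hstep V s c x₀ (by omega) hc1 (by rw [hx₀, hc2])
        have hg := hgood V (s + 1) c x₁ (by omega) hx₁
        have hsub : (residueBall p K (s + 1) c).filter
            (fun x => ¬ FlagMarked ψ S (η ^ (d + 1 + 1) * ρ) x) ⊆
            (residueBall p K (s + 1) c).filter (fun x => ¬ FlagMarked ψ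
              {W ∈ S | W ≠ V ∧ (V ≤ W ∨ W ≤ V)} (η ^ (d + 1) * (η * ρ)) x) ∪
            (residueBall p K (s + 1) c).filter (ψ V · < η * ψ V x₁) := by
          intro x hx
          rw [Finset.mem_filter] at hx
          rw [← Finset.filter_or, Finset.mem_filter]
          refine ⟨hx.1, ?_⟩
          by_contra hcon
          push Not at hcon
          refine hx.2 (FlagMarked.insert hV ?_ ?_ ?_)
          · rw [pow_succ η (d + 1), mul_assoc]; exact hcon.1
          · exact (hVlt x (mem_residueBall.mp hx.1).2).trans_le hρ1
          · refine le_trans ?_ hcon.2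
            calc η ^ (d + 1 + 1) * ρ = η ^ d * (η * (η * ρ)) := by ring
              _ ≤ 1 * (η * (η * ρ)) := by gcongr; exact pow_le_one₀ hη0.le hη1
              _ ≤ η * ψ V x₁ := by
                rw [one_mul]; gcongr; exact le_trans (by gcongr) hηx
        have hle := (Finset.card_le_card hsub).trans (Finset.card_union_le _ _)
        have hle' := (Nat.cast_le (α := ℝ)).mpr hle
        push_cast at hle' ⊢
        linarith
      · intro F hF hFc
        have hVF : V ∉ F := fun hmem => (hF hmem).2.1 rfl
        have := hS (Insert.insert V F) ?_ ?_
        · rw [Finset.card_insert_of_notMem hVF] at this; omega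
        · rw [Finset.coe_insert]
          rintro W (rfl | hW)
          exacts [hV, (hF hW).1]
        · rw [Finset.coe_insert]
          exact hFc.insert fun W hW _ => (hF hW).2.2
      · rintro W ⟨hW, -⟩
        obtain ⟨x₀, hx₀, hρx⟩ := h W hW
        obtain ⟨x₁, hx₁, hηx⟩ := hstep W s c x₀ (by omega) hc1 (by rw [hx₀, hc2])
        exact ⟨x₁, hx₁, le_trans (by gcongr) hηx⟩

/-- A `p`-adic Remez inequality: an integer polynomial of degree at most `D` is relatively small on
at most `D` residue classes. -/
theorem card_le_of_forall_norm_eval_lt {p : ℕ} [Fact p.Prime] {f : ℤ[X]} {D s m x₀ : ℕ}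
    (hf : f.natDegree ≤ D) {X : Finset ℕ} (hX : ∀ x ∈ X, x % p ^ s = x₀ % p ^ s)
    (hinj : Set.InjOn (· % p ^ (s + m)) (X : Set ℕ))
    (hlt : ∀ x ∈ X, ‖((f.eval (x : ℤ) : ℤ) : ℚ_[p])‖ <
      ((p : ℝ) ^ (m * D))⁻¹ * ‖((f.eval (x₀ : ℤ) : ℤ) : ℚ_[p])‖) : X.card ≤ D := by
  by_contra! hcard
  obtain ⟨Y, hYX, hY⟩ := Finset.exists_subset_card_eq (Nat.succ_le_of_lt hcard)
  have hp : 0 < (p : ℝ) := mod_cast (Fact.out : p.Prime).pos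
  set v : ℕ → ℚ_[p] := fun x => x with hv
  have hvinj : Set.InjOn v Y := Nat.cast_injective.injOn
  have hdeg : (f.map (Int.castRingHom ℚ_[p])).degree < Y.card := by
    refine degree_le_natDegree.trans_lt ?_
    rw [hY]
    exact_mod_cast (natDegree_map_le.trans hf).trans_lt (Nat.lt_succ_self D)
  have heval : ∀ x : ℕ, (f.map (Int.castRingHom ℚ_[p])).eval (v x) =
      ((f.eval (x : ℤ) : ℤ) : ℚ_[p]) := by
    intro x
    simp [hv]
  have hint := congrArg (eval (v x₀)) (Lagrange.eq_interpolate hvinj hdeg)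
  rw [Lagrange.interpolate_apply, eval_finsetSum, heval] at hint
  have hYne : Y.Nonempty := Finset.card_pos.mp (by omega)
  have hval : ∃ x ∈ Y, ‖((f.eval (x₀ : ℤ) : ℤ) : ℚ_[p])‖ ≤
      ‖((f.eval (x : ℤ) : ℤ) : ℚ_[p])‖ * (p : ℝ) ^ (m * D) := by
    obtain ⟨x, hx, hmax⟩ := IsUltrametricDist.exists_norm_finsetSum_le_of_nonempty hYne
      (fun i => eval (v x₀) (C (eval (v i) (f.map (Int.castRingHom ℚ_[p]))) *
        Lagrange.basis Y v i))
    refine ⟨x, hx, ?_⟩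
    rw [hint]
    refine hmax.trans ?_
    rw [eval_mul, eval_C, norm_mul, heval]
    gcongr
    rw [Lagrange.basis, eval_prod, norm_prod, pow_mul]
    have hc : (Y.erase x).card = D := by rw [Finset.card_erase_of_mem hx, hY]; rfl
    rw [← hc, ← Finset.prod_const]
    refine Finset.prod_le_prod (fun _ _ => norm_nonneg _) fun y hy => ?_
    obtain ⟨hyx, hyY⟩ := Finset.mem_erase.mp hy
    rw [Lagrange.basisDivisor, eval_mul, eval_C, norm_mul, norm_inv, eval_sub, eval_X, eval_C]
    have h1 : ‖v x₀ - v y‖ ≤ (p : ℝ) ^ (-(s : ℤ)) := by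
      have : v x₀ - v y = (((x₀ : ℤ) - y : ℤ) : ℚ_[p]) := by simp [hv]
      rw [this, Padic.norm_int_le_pow_iff_dvd]
      exact_mod_cast (Nat.modEq_iff_dvd.mp (hX y (hYX hyY)))
    have h2 : (p : ℝ) ^ (-((s + m : ℕ) : ℤ)) < ‖v x - v y‖ := by
      have : v x - v y = (((x : ℤ) - y : ℤ) : ℚ_[p]) := by simp [hv]
      rw [this]
      by_contra! hcon
      rw [Padic.norm_int_le_pow_iff_dvd] at hcon
      have : y ≡ x [MOD p ^ (s + m)] := Nat.modEq_iff_dvd.mpr (by exact_mod_cast hcon)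
      exact hyx (hinj (hYX hyY) (hYX hx) this)
    have h3 : 0 < (p : ℝ) ^ (-((s + m : ℕ) : ℤ)) := by positivity
    calc ‖v x - v y‖⁻¹ * ‖v x₀ - v y‖
        ≤ ((p : ℝ) ^ (-((s + m : ℕ) : ℤ)))⁻¹ * (p : ℝ) ^ (-(s : ℤ)) := by gcongr
      _ = (p : ℝ) ^ m := by
        rw [← zpow_neg, ← zpow_add₀ hp.ne', ← zpow_natCast]; congr 1; push_cast; ring
  obtain ⟨x, hx, hle⟩ := hval
  have := hlt x (hYX hx)
  rw [inv_mul_eq_div, lt_div_iff₀ (by positivity)] at this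
  exact absurd hle (not_le.mpr this)

/-- The function `g` is, up to scaling, pointwise a maximum of `p`-adic absolute values of integer
polynomials of degree at most `D`. -/
def IsPadicPolyMax (p : ℕ) [Fact p.Prime] (D : ℕ) (g : ℕ → ℝ) : Prop :=
  ∀ x₀, ∃ f : ℤ[X], ∃ w : ℝ, f.natDegree ≤ D ∧ 0 ≤ w ∧
    g x₀ = w * ‖((f.eval (x₀ : ℤ) : ℤ) : ℚ_[p])‖ ∧
    ∀ x : ℕ, w * ‖((f.eval (x : ℤ) : ℤ) : ℚ_[p])‖ ≤ g x

open Classical in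
theorem IsPadicPolyMax.card_lt_le {p : ℕ} [Fact p.Prime] {D : ℕ} {g : ℕ → ℝ}
    (hg : IsPadicPolyMax p D g) {K s m a x₀ : ℕ} (hK : s + m ≤ K) (hx₀ : x₀ % p ^ s = a) :
    ((residueBall p K s a).filter (g · < ((p : ℝ) ^ (m * D))⁻¹ * g x₀)).card ≤
      D * p ^ (K - (s + m)) := by
  obtain ⟨f, w, hf, hw, hfx₀, hfle⟩ := hg x₀
  have hp : 0 < p := (Fact.out : p.Prime).pos
  set S := (residueBall p K s a).filter (g · < ((p : ℝ) ^ (m * D))⁻¹ * g x₀) with hS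
  have hcard : (S.image (· % p ^ (s + m))).card ≤ D := by
    obtain ⟨X, hXS, hinj, himg⟩ := Finset.exists_subset_injOn_image_eq_of_surjOn
      (f := (· % p ^ (s + m))) (S : Set ℕ) (S.image (· % p ^ (s + m)))
      (by rw [Finset.coe_image]; exact Set.surjOn_image _ _)
    rw [← himg, Finset.card_image_of_injOn hinj]
    refine card_le_of_forall_norm_eval_lt (x₀ := x₀) hf (fun x hx => ?_) hinj fun x hx => ?_
    · have := hXS hx
      rw [hS, Finset.mem_coe, Finset.mem_filter, mem_residueBall] at this
      rw [hx₀, this.1.2]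
    · have := hXS hx
      rw [hS, Finset.mem_coe, Finset.mem_filter] at this
      have h := (hfle x).trans_lt this.2
      rw [hfx₀, mul_left_comm] at h
      exact lt_of_mul_lt_mul_left h hw
  calc S.card ≤ p ^ (K - (s + m)) * (S.image (· % p ^ (s + m))).card := by
        refine Finset.card_le_mul_card_image _ _ fun c hc => ?_
        obtain ⟨y, -, rfl⟩ := Finset.mem_image.mp hc
        rw [← card_residueBall hp hK (Nat.mod_lt y (pow_pos hp (s + m)))]
        refine Finset.card_le_card fun x hx => ?_
        rw [Finset.mem_filter] at hx
        exact mem_residueBall.mpr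
          ⟨(mem_residueBall.mp (Finset.mem_filter.mp hx.1).1).1, hx.2⟩
    _ ≤ _ := by rw [mul_comm]; gcongr

theorem IsPadicPolyMax.exists_child {p : ℕ} [Fact p.Prime] {D : ℕ} {g : ℕ → ℝ}
    (hg : IsPadicPolyMax p D g) {s m c x₀ : ℕ} (hm : D * p < p ^ m)
    (hc : c < p ^ (s + 1)) (hx₀ : x₀ % p ^ s = c % p ^ s) :
    ∃ x₁, x₁ % p ^ (s + 1) = c ∧ ((p : ℝ) ^ (m * D))⁻¹ * g x₀ ≤ g x₁ := by
  classical
  by_contra! hcon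
  have hp : 0 < p := (Fact.out : p.Prime).pos
  have h := hg.card_lt_le (K := s + m + 1) (by omega) hx₀ (m := m)
  have hsub : residueBall p (s + m + 1) (s + 1) c ⊆ (residueBall p (s + m + 1) s (c % p ^ s)).filter
      (g · < ((p : ℝ) ^ (m * D))⁻¹ * g x₀) := by
    intro x hx
    obtain ⟨h1, h2⟩ := mem_residueBall.mp hx
    refine Finset.mem_filter.mpr ⟨mem_residueBall.mpr ⟨h1, ?_⟩, hcon x h2⟩
    rw [← h2, Nat.mod_mod_of_dvd _ (pow_dvd_pow p s.le_succ)]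
  have := (Finset.card_le_card hsub).trans h
  rw [card_residueBall hp (by omega) hc, show s + m + 1 - (s + 1) = m by omega,
    show s + m + 1 - (s + m) = 1 by omega, pow_one] at this
  omega

/-- The matrix of the Taylor expansion at `x` in the monomial basis: row `a` lists the Taylor
coefficients of `X ^ a` at `x`. -/
def taylorMatrix (R : Type*) [CommRing R] (N : ℕ) (x : R) : Matrix (Fin N) (Fin N) R :=
  .of fun a l => (a.val.choose l.val : R) * x ^ (a.val - l.val)

/-- The exponents of the congruences imposed on the Taylor coefficients. -/
def closeExp (k l : ℕ) : ℕ := if l = 0 then 2 * k else if l = 1 then k else 0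

/-- Coefficient vectors of polynomials whose value at `x` is divisible by `p ^ (2 * k)` and whose
derivative at `x` is divisible by `p ^ k`. -/
def IsClose (p k : ℕ) {N : ℕ} (x : ℤ) (v : Fin N → ℤ) : Prop :=
  ∀ l : Fin N, (p : ℤ) ^ closeExp k l ∣ Matrix.vecMul v (taylorMatrix ℤ N x) l

/-- The minors of the matrix of Taylor coefficients at `x` of the rows of `b`. -/
def taylorMinor {j N : ℕ} (x : ℤ) (b : Matrix (Fin j) (Fin N) ℤ) (σ : Fin j → Fin N) : ℤ :=
  ((b * taylorMatrix ℤ N x).submatrix id σ).det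

/-- The largest absolute value of a maximal minor. -/
noncomputable def archSize {j N : ℕ} (b : Matrix (Fin j) (Fin N) ℤ) : ℝ :=
  ‖fun σ : Fin j → Fin N => (b.submatrix id σ).det‖

/-- The weighted maximum of the `p`-adic absolute values of the Taylor minors. -/
noncomputable def padicSize (p k : ℕ) [Fact p.Prime] {j N : ℕ} (x : ℤ)
    (b : Matrix (Fin j) (Fin N) ℤ) : ℝ :=
  max 1 ‖fun σ : Fin j → Fin N =>
    (p : ℝ) ^ (∑ i, closeExp k (σ i)) * ‖(taylorMinor x b σ : ℚ_[p])‖‖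

section Sizes

variable {p k j N : ℕ} [Fact p.Prime]

theorem archSize_nonneg (b : Matrix (Fin j) (Fin N) ℤ) : 0 ≤ archSize b := norm_nonneg _

theorem one_le_padicSize (x : ℤ) (b : Matrix (Fin j) (Fin N) ℤ) : 1 ≤ padicSize p k x b :=
  le_max_left _ _

theorem le_padicSize (x : ℤ) (b : Matrix (Fin j) (Fin N) ℤ) (σ : Fin j → Fin N) :
    (p : ℝ) ^ (∑ i, closeExp k (σ i)) * ‖(taylorMinor x b σ : ℚ_[p])‖ ≤ padicSize p k x b := by
  refine le_trans ?_ (le_max_right _ _)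
  refine (Real.le_norm_self _).trans ?_
  exact norm_le_pi_norm (fun σ : Fin j → Fin N =>
    (p : ℝ) ^ (∑ i, closeExp k (σ i)) * ‖(taylorMinor x b σ : ℚ_[p])‖) σ

theorem padicSize_le {x : ℤ} {b : Matrix (Fin j) (Fin N) ℤ} {c : ℝ} (hc : 1 ≤ c)
    (h : ∀ σ : Fin j → Fin N,
      (p : ℝ) ^ (∑ i, closeExp k (σ i)) * ‖(taylorMinor x b σ : ℚ_[p])‖ ≤ c) :
    padicSize p k x b ≤ c := by
  refine max_le hc ((pi_norm_le_iff_of_nonneg (by linarith)).mpr fun σ => ?_)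
  rw [Real.norm_of_nonneg (by positivity)]
  exact h σ

theorem padicSize_eq_one_or_exists (x : ℤ) (b : Matrix (Fin j) (Fin N) ℤ) :
    padicSize p k x b = 1 ∨ ∃ σ : Fin j → Fin N, padicSize p k x b =
      (p : ℝ) ^ (∑ i, closeExp k (σ i)) * ‖(taylorMinor x b σ : ℚ_[p])‖ := by
  by_contra! h
  obtain ⟨h1, h2⟩ := h
  rcases isEmpty_or_nonempty (Fin j → Fin N) with hE | hE
  · exact h1 (le_antisymm (padicSize_le le_rfl fun σ => hE.elim σ) (one_le_padicSize x b))
  obtain ⟨σ, hσ⟩ := Finite.exists_max fun σ : Fin j → Fin N =>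
    (p : ℝ) ^ (∑ i, closeExp k (σ i)) * ‖(taylorMinor x b σ : ℚ_[p])‖
  rcases le_total 1 ((p : ℝ) ^ (∑ i, closeExp k (σ i)) * ‖(taylorMinor x b σ : ℚ_[p])‖) with h | h
  · exact h2 σ (le_antisymm (padicSize_le h hσ) (le_padicSize x b σ))
  · exact h1 (le_antisymm (padicSize_le le_rfl fun τ => (hσ τ).trans h) (one_le_padicSize x b))

theorem exists_polynomial_taylorMinor (b : Matrix (Fin j) (Fin N) ℤ) (σ : Fin j → Fin N) :
    ∃ f : ℤ[X], f.natDegree ≤ j * N ∧ ∀ x, f.eval x = taylorMinor x b σ := by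
  refine ⟨((b.map C * taylorMatrix ℤ[X] N X).submatrix id σ).det, ?_, fun x => ?_⟩
  · rw [Matrix.det_apply]
    refine natDegree_sum_le_of_forall_le _ _ fun τ _ => ?_
    refine (natDegree_smul_le _ _).trans ((natDegree_prod_le _ _).trans ?_)
    refine (Finset.sum_le_card_nsmul _ _ N fun i _ => ?_).trans (by simp)
    rw [Matrix.submatrix_apply, Matrix.mul_apply]
    refine natDegree_sum_le_of_forall_le _ _ fun a _ => ?_
    simp only [Matrix.map_apply, taylorMatrix, Matrix.of_apply]
    refine (natDegree_C_mul_le _ _).trans ?_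
    rw [← C_eq_natCast]
    refine (natDegree_C_mul_le _ _).trans ?_
    rw [natDegree_X_pow]
    omega
  · rw [taylorMinor, ← coe_evalRingHom, RingHom.map_det]
    congr 1
    ext i l
    simp [Matrix.mul_apply, taylorMatrix, eval_finsetSum]

theorem isPadicPolyMax_padicSize (hj : j ≤ N) (b : Matrix (Fin j) (Fin N) ℤ) {c : ℝ} (hc : 0 ≤ c) :
    IsPadicPolyMax p (N * N) fun x => c * padicSize p k x b := by
  intro x₀
  rcases padicSize_eq_one_or_exists (p := p) (k := k) (x₀ : ℤ) b with h | ⟨σ, h⟩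
  · refine ⟨1, c, by simp, hc, by simp [h], fun x => ?_⟩
    simpa using le_mul_of_one_le_right hc (one_le_padicSize (p := p) (k := k) (x : ℤ) b)
  · obtain ⟨f, hf, hfx⟩ := exists_polynomial_taylorMinor b σ
    refine ⟨f, c * (p : ℝ) ^ (∑ i, closeExp k (σ i)), hf.trans (by gcongr), by positivity, ?_,
      fun x => ?_⟩
    · simp only [h, hfx, mul_assoc]
    · rw [hfx, mul_assoc]
      exact mul_le_mul_of_nonneg_left (le_padicSize _ b σ) hc

theorem padicSize_le_of_modEq (hj : j ≤ N) (b : Matrix (Fin j) (Fin N) ℤ) {x y : ℤ}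
    (h : (p : ℤ) ^ (2 * k * N) ∣ x - y) : padicSize p k x b ≤ padicSize p k y b := by
  refine padicSize_le (one_le_padicSize _ _) fun σ => ?_
  obtain ⟨f, -, hfx⟩ := exists_polynomial_taylorMinor b σ
  have hd : (p : ℤ) ^ (2 * k * N) ∣ taylorMinor x b σ - taylorMinor y b σ := by
    rw [← hfx, ← hfx]; exact h.trans (Polynomial.sub_dvd_eval_sub x y f)
  have hp1 : 1 ≤ (p : ℝ) := mod_cast (Fact.out : p.Prime).one_lt.le
  have hn := (Padic.norm_int_le_pow_iff_dvd (p := p) (taylorMinor x b σ - taylorMinor y b σ)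
    (2 * k * N)).mpr (by exact_mod_cast hd)
  have hsum : ∑ i, closeExp k (σ i) ≤ 2 * k * N := by
    refine (Finset.sum_le_card_nsmul _ _ (2 * k) fun i _ => ?_).trans ?_
    · unfold closeExp; split_ifs <;> omega
    · simp only [Finset.card_univ, Fintype.card_fin, smul_eq_mul]
      rw [mul_comm]; gcongr
  have h3 : ‖(taylorMinor x b σ : ℚ_[p])‖ ≤
      max ‖((taylorMinor x b σ - taylorMinor y b σ : ℤ) : ℚ_[p])‖ ‖(taylorMinor y b σ : ℚ_[p])‖ := by
    have := IsUltrametricDist.norm_add_le_max ((taylorMinor x b σ - taylorMinor y b σ : ℤ) : ℚ_[p])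
      (taylorMinor y b σ : ℚ_[p])
    simpa using this
  rcases le_max_iff.mp h3 with h4 | h4
  · calc _ ≤ (p : ℝ) ^ (2 * k * N) * (p : ℝ) ^ (-((2 * k * N : ℕ) : ℤ)) := by
          gcongr
          exact h4.trans hn
      _ = 1 := by
        rw [zpow_neg, zpow_natCast]
        exact mul_inv_cancel₀ (by positivity)
      _ ≤ _ := one_le_padicSize _ _
  · exact le_trans (by gcongr) (le_padicSize y b σ)

theorem one_le_natAbs_mul_norm {z : ℤ} (hz : z ≠ 0) : 1 ≤ ‖z‖ * ‖(z : ℚ_[p])‖ := by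
  have hv : (p : ℤ) ^ padicValInt p z ∣ z := padicValInt_dvd z
  have hn : ‖(z : ℚ_[p])‖ = ((p : ℝ) ^ padicValInt p z)⁻¹ := by
    rw [← Rat.cast_intCast, Padic.eq_padicNorm, padicNorm.eq_zpow_of_nonzero (by exact_mod_cast hz),
      padicValRat.of_int]
    push_cast
    rw [zpow_neg, zpow_natCast]
  have hp : 0 < (p : ℝ) := mod_cast (Fact.out : p.Prime).pos
  rw [hn, ← div_eq_mul_inv, one_le_div (by positivity), Int.norm_eq_abs]
  have := Int.le_of_dvd (abs_pos.mpr hz) ((dvd_abs _ _).mpr hv)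
  exact_mod_cast this

theorem archSize_cons_le (v : Fin N → ℤ) (b : Matrix (Fin j) (Fin N) ℤ) :
    archSize (Matrix.of (Fin.cons v b : Fin (j + 1) → Fin N → ℤ)) ≤ (j + 1) * ‖v‖ * archSize b := by
  refine (pi_norm_le_iff_of_nonneg (by have := archSize_nonneg b; positivity)).mpr fun σ => ?_
  rw [Matrix.det_succ_row_zero]
  refine (norm_sum_le _ _).trans ?_
  have : (j + 1) * ‖v‖ * archSize b = ∑ _i : Fin (j + 1), ‖v‖ * archSize b := by
    simp [mul_assoc]
  rw [this]
  refine Finset.sum_le_sum fun i _ => ?_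
  rw [norm_mul, norm_mul, norm_pow, norm_neg, norm_one, one_pow, one_mul]
  gcongr
  · exact norm_le_pi_norm v (σ i)
  · exact norm_le_pi_norm (fun τ : Fin j → Fin N => (b.submatrix id τ).det) (σ ∘ i.succAbove)

theorem taylorMinor_cons_le {x : ℤ} {v : Fin N → ℤ} (hv : IsClose p k x v)
    (b : Matrix (Fin j) (Fin N) ℤ) (σ : Fin (j + 1) → Fin N) :
    (p : ℝ) ^ (∑ i, closeExp k (σ i)) *
      ‖(taylorMinor x (Matrix.of (Fin.cons v b : Fin (j + 1) → Fin N → ℤ)) σ : ℚ_[p])‖ ≤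
        padicSize p k x b := by
  have hp : 0 < (p : ℝ) := mod_cast (Fact.out : p.Prime).pos
  rw [taylorMinor, Matrix.det_succ_row_zero, Int.cast_sum]
  have hpos : 0 < (p : ℝ) ^ (∑ i, closeExp k (σ i)) := by positivity
  rw [← le_div_iff₀' hpos]
  refine IsUltrametricDist.norm_sum_le_of_forall_le_of_nonneg
    (div_nonneg (zero_le_one.trans (one_le_padicSize _ _)) hpos.le) fun i _ => ?_
  rw [le_div_iff₀' hpos, Fin.sum_univ_succAbove _ i, pow_add]
  have h1 : (p : ℝ) ^ closeExp k (σ i) *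
      ‖((Matrix.vecMul v (taylorMatrix ℤ N x) (σ i) : ℤ) : ℚ_[p])‖ ≤ 1 := by
    have := (Padic.norm_int_le_pow_iff_dvd (p := p) _ _).mpr (by exact_mod_cast hv (σ i))
    rw [zpow_neg, zpow_natCast] at this
    rwa [← le_inv_mul_iff₀ (by positivity), mul_one]
  have h2 := le_padicSize (p := p) (k := k) x b (σ ∘ i.succAbove)
  have h3 : ((Matrix.of (Fin.cons v b : Fin (j + 1) → Fin N → ℤ) * taylorMatrix ℤ N x).submatrix id σ
      0 i) = Matrix.vecMul v (taylorMatrix ℤ N x) (σ i) := by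
    simp [Matrix.mul_apply, Matrix.vecMul, dotProduct]
    rfl
  have h4 : (((Matrix.of (Fin.cons v b : Fin (j + 1) → Fin N → ℤ) * taylorMatrix ℤ N x).submatrix
      id σ).submatrix Fin.succ i.succAbove).det = taylorMinor x b (σ ∘ i.succAbove) := by
    rw [taylorMinor]
    congr 1
  rw [h3, h4]
  push_cast
  rw [norm_mul, norm_mul, norm_pow, norm_neg, norm_one, one_pow, one_mul]
  calc _ = ((p : ℝ) ^ closeExp k (σ i) * ‖((Matrix.vecMul v (taylorMatrix ℤ N x) (σ i) : ℤ) : ℚ_[p])‖) *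
        ((p : ℝ) ^ (∑ l, closeExp k (σ (i.succAbove l))) *
          ‖(taylorMinor x b (σ ∘ i.succAbove) : ℚ_[p])‖) := by ring
    _ ≤ 1 * padicSize p k x b := by
      gcongr
      exact h2
    _ = _ := one_mul _

/-- The rows of `b` form a basis of the lattice of integer vectors in `V`. -/
structure IsIntBasis (V : Submodule ℚ (Fin N → ℚ)) (b : Matrix (Fin j) (Fin N) ℤ) : Prop where
  linearIndependent : LinearIndependent ℤ b
  mem_iff : ∀ v : Fin N → ℤ, (fun i => (v i : ℚ)) ∈ V ↔ ∃ c : Fin j → ℤ, Matrix.vecMul c b = v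

theorem archSize_mul_padicSize_le {V W : Submodule ℚ (Fin N → ℚ)} {b : Matrix (Fin j) (Fin N) ℤ}
    {b' : Matrix (Fin (j + 1)) (Fin N) ℤ} (hb : IsIntBasis V b) (hb' : IsIntBasis W b')
    (hVW : V ≤ W) {x : ℤ} {v : Fin N → ℤ} (hv : IsClose p k x v)
    (hvV : (fun i => (v i : ℚ)) ∉ V) (hvW : (fun i => (v i : ℚ)) ∈ W) :
    archSize b' * padicSize p k x b' ≤ (j + 1) * ‖v‖ * (archSize b * padicSize p k x b) := by
  set M : Matrix (Fin (j + 1)) (Fin N) ℤ := Matrix.of (Fin.cons v b : Fin (j + 1) → Fin N → ℤ)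
    with hM
  have hrow : ∀ i, ∃ c : Fin (j + 1) → ℤ, Matrix.vecMul c b' = M i := by
    intro i
    rw [← hb'.mem_iff]
    refine Fin.cases ?_ (fun i => ?_) i
    · exact hvW
    · exact hVW ((hb.mem_iff _).mpr ⟨Pi.single i 1, by simp [hM]; rfl⟩)
  choose A hA using hrow
  have hMA : M = Matrix.of A * b' := by
    ext i l
    rw [← hA i]
    simp [Matrix.mul_apply, Matrix.vecMul, dotProduct]
  have hdet : (Matrix.of A).det ≠ 0 := by
    intro h0
    obtain ⟨c, hc0, hc⟩ := Matrix.exists_vecMul_eq_zero_iff.mpr h0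
    have hcM : Matrix.vecMul c M = 0 := by
      rw [hMA, ← Matrix.vecMul_vecMul, hc, Matrix.zero_vecMul]
    have hcM' : c 0 • v + Matrix.vecMul (Fin.tail c) b = 0 := by
      rw [← hcM]
      ext l
      simp [Matrix.vecMul, dotProduct, Fin.sum_univ_succ, hM, Fin.tail]
      rfl
    have hc0' : c 0 = 0 := by
      by_contra hne
      refine hvV ?_
      have hmem : (fun i => ((Matrix.vecMul (Fin.tail c) b) i : ℚ)) ∈ V := (hb.mem_iff _).mpr ⟨_, rfl⟩
      have : (fun i => (v i : ℚ)) = (-(c 0 : ℚ))⁻¹ •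
          (fun i => ((Matrix.vecMul (Fin.tail c) b) i : ℚ)) := by
        have hne' : (-(c 0 : ℚ)) ≠ 0 := neg_ne_zero.mpr (by exact_mod_cast hne)
        rw [eq_inv_smul_iff₀ hne']
        ext i
        have := congrArg (Int.cast (R := ℚ)) (congrFun hcM' i)
        simp only [Pi.add_apply, Pi.smul_apply, smul_eq_mul, Pi.zero_apply, Int.cast_add,
          Int.cast_mul, Int.cast_zero] at this ⊢
        linarith
      rw [this]
      exact V.smul_mem _ hmem
    have hlin := Fintype.linearIndependent_iff.mp hb.linearIndependent (Fin.tail c) (by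
      rw [hc0', zero_smul, zero_add] at hcM'
      rw [← hcM']
      ext l
      simp [Matrix.vecMul, dotProduct, Finset.sum_apply])
    refine hc0 (funext fun i => Fin.cases hc0' (fun i => ?_) i)
    exact hlin i
  set z := (Matrix.of A).det with hz
  have harch : ‖z‖ * archSize b' ≤ archSize M := by
    have hzz : archSize M = ‖z • fun σ : Fin (j + 1) → Fin N => (b'.submatrix id σ).det‖ := by
      rw [archSize]
      congr 1
      ext σ
      have : M.submatrix id σ = Matrix.of A * b'.submatrix id σ := by
        rw [hMA]; rfl
      rw [this, Matrix.det_mul]; rfl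
    rw [hzz, norm_smul]; rfl
  have hz0 : 0 < ‖(z : ℚ_[p])‖ := norm_pos_iff.mpr (by exact_mod_cast hdet)
  have hz1 : ‖(z : ℚ_[p])‖ ≤ 1 := Padic.norm_int_le_one z
  have hpad : padicSize p k x b' ≤ ‖(z : ℚ_[p])‖⁻¹ * padicSize p k x b := by
    refine padicSize_le ?_ fun σ => ?_
    · exact one_le_mul_of_one_le_of_one_le ((one_le_inv₀ hz0).mpr hz1) (one_le_padicSize _ _)
    · have h1 := taylorMinor_cons_le hv b σ
      have h2 : taylorMinor x M σ = z * taylorMinor x b' σ := by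
        have : (M * taylorMatrix ℤ N x).submatrix id σ =
            Matrix.of A * (b' * taylorMatrix ℤ N x).submatrix id σ := by
          rw [hMA, Matrix.mul_assoc]; rfl
        rw [taylorMinor, this, Matrix.det_mul]; rfl
      rw [← hM, h2] at h1
      push_cast at h1
      rw [norm_mul] at h1
      rw [le_inv_mul_iff₀ hz0]
      linarith
  have hz2 : 1 ≤ ‖z‖ * ‖(z : ℚ_[p])‖ := one_le_natAbs_mul_norm hdet
  have hcons := archSize_cons_le v b
  rw [← hM] at hcons
  have hP := one_le_padicSize (p := p) (k := k) x b
  have hP' := one_le_padicSize (p := p) (k := k) x b'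
  calc archSize b' * padicSize p k x b'
      ≤ archSize b' * (‖(z : ℚ_[p])‖⁻¹ * padicSize p k x b) := by
        gcongr; exact archSize_nonneg b'
    _ ≤ (‖z‖ * ‖(z : ℚ_[p])‖) * (archSize b' * (‖(z : ℚ_[p])‖⁻¹ * padicSize p k x b)) :=
        le_mul_of_one_le_left (mul_nonneg (archSize_nonneg b') (by positivity)) hz2
    _ = ‖z‖ * archSize b' * padicSize p k x b := by field_simp
    _ ≤ (j + 1) * ‖v‖ * archSize b * padicSize p k x b := by
        exact mul_le_mul_of_nonneg_right (harch.trans hcons) (by positivity)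
    _ = _ := by ring

end Sizes

section LinearAlgebra

variable {K : Type*} [Field K] {j N : ℕ}

theorem exists_det_submatrix_ne_zero {A : Matrix (Fin j) (Fin N) K}
    (hA : LinearIndependent K A.row) {s : Set (Fin N)} (hs : LinearIndepOn K A.col s) :
    ∃ σ : Fin j → Fin N, s ⊆ Set.range σ ∧ (A.submatrix id σ).det ≠ 0 := by
  obtain ⟨t, -, hst, hspan, ht⟩ := exists_linearIndepOn_extension hs (Set.subset_univ s)
  have := Fintype.ofFinite t
  have hcard : Nat.card t = j := by
    have h1 := finrank_span_eq_card ht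
    have h2 : Set.range (fun i : t => A.col i) = A.col '' t := by
      rw [Set.image_eq_range]
    have h3 : Submodule.span K (A.col '' t) = Submodule.span K (Set.range A.col) := by
      refine le_antisymm (Submodule.span_mono (Set.image_subset_range _ _)) ?_
      rw [Submodule.span_le, ← Set.image_univ]
      exact hspan
    rw [h2, h3, ← Matrix.rank_eq_finrank_span_cols, hA.rank_matrix, Fintype.card_fin] at h1
    rw [Nat.card_eq_fintype_card, ← h1]
  let e : Fin j ≃ t := (Finite.equivFinOfCardEq hcard).symm
  refine ⟨fun i => e i, fun l hl => ?_, ?_⟩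
  · obtain ⟨i, hi⟩ := e.surjective ⟨l, hst hl⟩
    exact ⟨i, by simp [hi]⟩
  · have : LinearIndependent K (A.submatrix id fun i => (e i : Fin N)).col :=
      ht.comp e e.injective
    rw [Matrix.linearIndependent_cols_iff_isUnit, Matrix.isUnit_iff_isUnit_det] at this
    exact this.ne_zero

end LinearAlgebra

/-- The polynomial with the given coefficients. -/
noncomputable def polyOfCoeffs {R : Type*} [CommRing R] {N : ℕ} (v : Fin N → R) : R[X] :=
  ∑ a, monomial a.val (v a)

section PolyOfCoeffs

variable {R : Type*} [CommRing R] {N : ℕ}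

theorem coeff_polyOfCoeffs (v : Fin N → R) (a : Fin N) : (polyOfCoeffs v).coeff a = v a := by
  simp only [polyOfCoeffs, finsetSum_coeff, coeff_monomial, Fin.val_inj]
  simp

theorem coeff_polyOfCoeffs_of_le (v : Fin N → R) {a : ℕ} (ha : N ≤ a) :
    (polyOfCoeffs v).coeff a = 0 := by
  simp only [polyOfCoeffs, finsetSum_coeff, coeff_monomial]
  exact Finset.sum_eq_zero fun i _ => if_neg (by omega)

theorem polyOfCoeffs_eq_zero {v : Fin N → R} : polyOfCoeffs v = 0 ↔ v = 0 := by
  refine ⟨fun h => funext fun a => ?_, fun h => by simp [h, polyOfCoeffs]⟩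
  rw [← coeff_polyOfCoeffs v a, h]; rfl

theorem natDegree_polyOfCoeffs_le (v : Fin N → R) : (polyOfCoeffs v).natDegree ≤ N - 1 := by
  rw [natDegree_le_iff_coeff_eq_zero]
  exact fun a ha => coeff_polyOfCoeffs_of_le v (by omega)

theorem polyOfCoeffs_coeff {P : R[X]} (hP : P.natDegree < N) :
    polyOfCoeffs (fun a : Fin N => P.coeff a) = P := by
  ext a
  rcases lt_or_ge a N with ha | ha
  · exact coeff_polyOfCoeffs _ ⟨a, ha⟩
  · rw [coeff_polyOfCoeffs_of_le _ ha, coeff_eq_zero_of_natDegree_lt (by omega)]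

theorem vecMul_taylorMatrix_zero (v : Fin N → R) (x : R) (h : 0 < N) :
    Matrix.vecMul v (taylorMatrix R N x) ⟨0, h⟩ = (polyOfCoeffs v).eval x := by
  simp [Matrix.vecMul, dotProduct, taylorMatrix, polyOfCoeffs, eval_finsetSum]

theorem vecMul_taylorMatrix_one (v : Fin N → R) (x : R) (h : 1 < N) :
    Matrix.vecMul v (taylorMatrix R N x) ⟨1, h⟩ = (derivative (polyOfCoeffs v)).eval x := by
  simp [Matrix.vecMul, dotProduct, taylorMatrix, polyOfCoeffs, eval_finsetSum,
    derivative_monomial, mul_assoc]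

theorem det_taylorMatrix (x : R) : (taylorMatrix R N x).det = 1 := by
  rw [Matrix.det_of_isLowerTriangular]
  · simp [taylorMatrix]
  · intro a l hal
    have : a.val < l.val := hal
    simp [taylorMatrix, Nat.choose_eq_zero_of_lt this]

end PolyOfCoeffs

theorem wronskian_ne_zero {K : Type*} [Field K] [CharZero K] {f g : K[X]}
    (h : LinearIndependent K ![f, g]) : wronskian f g ≠ 0 := by
  classical
  intro hw
  rw [LinearIndependent.pair_iff] at h
  have hd : gcd f g ≠ 0 := by
    intro h0
    rw [gcd_eq_zero_iff] at h0
    simpa using h 1 0 (by simp [h0.1])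
  obtain ⟨f', g', hf, hg, hu⟩ := extract_gcd f g
  have hco : IsCoprime f' g' := by rwa [← gcd_isUnit_iff]
  set d := gcd f g
  have hw' : wronskian f' g' = 0 := by
    have : wronskian f g = d ^ 2 * wronskian f' g' := by
      rw [hf, hg]
      simp only [wronskian, derivative_mul]
      ring
    rw [this] at hw
    exact (mul_eq_zero.mp hw).resolve_left (pow_ne_zero 2 hd)
  obtain ⟨h1, h2⟩ := hco.wronskian_eq_zero_iff.mp hw'
  obtain ⟨a, rfl⟩ : ∃ a, f' = C a := ⟨_, eq_C_of_derivative_eq_zero h1⟩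
  obtain ⟨b, rfl⟩ : ∃ b, g' = C b := ⟨_, eq_C_of_derivative_eq_zero h2⟩
  obtain ⟨hb, ha⟩ := h b (-a) (by
    rw [hf, hg, smul_eq_C_mul, smul_eq_C_mul, C_neg]
    ring)
  rw [neg_eq_zero] at ha
  rw [ha, hb, C_0] at hco
  exact not_isCoprime_zero_zero hco

theorem exists_natCast_eval_ne_zero {K : Type*} [Field K] [CharZero K] {f : K[X]} (hf : f ≠ 0)
    {d : ℕ} (hd : f.natDegree ≤ d) : ∃ x < d + 1, f.eval (x : K) ≠ 0 := by
  by_contra! h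
  exact hf (eq_zero_of_natDegree_lt_card_of_eval_eq_zero f
    (f := fun i : Fin (d + 1) => (i.val : K)) (fun i l hil => Fin.ext (Nat.cast_injective hil))
    (fun i => h i i.isLt) (by rw [Fintype.card_fin]; omega))

theorem exists_taylor_det_ne_zero {K : Type*} [Field K] [CharZero K] {j N : ℕ} (hN : 2 ≤ N)
    {b : Matrix (Fin j) (Fin N) K} (hb : LinearIndependent K b.row) :
    ∃ x < 2 * N + 1, ∃ σ : Fin j → Fin N, (∀ l : Fin N, l.val < j → l.val < 2 → l ∈ Set.range σ) ∧
      ((b * taylorMatrix K N x).submatrix id σ).det ≠ 0 := by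
  have h0 : ∀ (x : K) i, (b * taylorMatrix K N x) i ⟨0, by omega⟩ = (polyOfCoeffs (b i)).eval x :=
    fun x i => vecMul_taylorMatrix_zero (b i) x _
  have h1 : ∀ (x : K) i, (b * taylorMatrix K N x) i ⟨1, by omega⟩ =
      (derivative (polyOfCoeffs (b i))).eval x := fun x i => vecMul_taylorMatrix_one (b i) x _
  have hrow : ∀ x : K, LinearIndependent K (b * taylorMatrix K N x).row := by
    intro x
    rw [← Matrix.vecMul_injective_iff] at hb ⊢
    have hT : IsUnit (taylorMatrix K N x) := by
      rw [Matrix.isUnit_iff_isUnit_det, det_taylorMatrix]; exact isUnit_one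
    intro u v huv
    simp only [← Matrix.vecMul_vecMul] at huv
    exact hb (Matrix.vecMul_injective_of_isUnit hT huv)
  suffices h : ∃ x < 2 * N + 1, LinearIndepOn K (b * taylorMatrix K N (x : K)).col
      {l : Fin N | l.val < j ∧ l.val < 2} by
    obtain ⟨x, hx, hs⟩ := h
    obtain ⟨σ, hσ, hdet⟩ := exists_det_submatrix_ne_zero (hrow x) hs
    exact ⟨x, hx, σ, fun l h1 h2 => hσ ⟨h1, h2⟩, hdet⟩
  rcases j with - | - | j
  · refine ⟨0, by omega, ?_⟩
    simp
  · obtain ⟨x, hx, hfx⟩ := exists_natCast_eval_ne_zero (f := polyOfCoeffs (b 0))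
      (fun h => hb.ne_zero 0 (polyOfCoeffs_eq_zero.mp h))
      ((natDegree_polyOfCoeffs_le _).trans (show N - 1 ≤ 2 * N by omega))
    refine ⟨x, hx, ?_⟩
    have : {l : Fin N | l.val < 0 + 1 ∧ l.val < 2} = {⟨0, by omega⟩} := by
      ext l; simp [Fin.ext_iff]; omega
    rw [this, linearIndepOn_singleton_iff]
    intro h
    refine hfx ?_
    rw [← h0]
    exact congrFun h 0
  · set f := polyOfCoeffs (b 0)
    set g := polyOfCoeffs (b 1)
    have hw : wronskian f g ≠ 0 := by
      refine wronskian_ne_zero ?_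
      rw [LinearIndependent.pair_iff]
      intro s t hst
      have hz : s • b 0 + t • b 1 = 0 := by
        rw [← polyOfCoeffs_eq_zero, ← hst]
        simp [f, g, polyOfCoeffs, Finset.smul_sum, Finset.sum_add_distrib, smul_monomial]
      have hpair : LinearIndependent K ![b 0, b 1] := by
        have := hb.comp ![0, 1] (by intro u v; fin_cases u <;> fin_cases v <;> simp)
        convert this using 1
        ext u
        fin_cases u <;> rfl
      exact LinearIndependent.pair_iff.mp hpair s t hz
    obtain ⟨x, hx, hwx⟩ := exists_natCast_eval_ne_zero hw (d := 2 * N) (by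
      refine (natDegree_sub_le _ _).trans (max_le ?_ ?_) <;>
      refine natDegree_mul_le.trans ?_ <;>
      have hf : f.natDegree ≤ N - 1 := natDegree_polyOfCoeffs_le (b 0) <;>
      have hg : g.natDegree ≤ N - 1 := natDegree_polyOfCoeffs_le (b 1) <;>
      have hf' := natDegree_derivative_le f <;>
      have hg' := natDegree_derivative_le g <;>
      omega)
    refine ⟨x, hx, ?_⟩
    have : {l : Fin N | l.val < j + 1 + 1 ∧ l.val < 2} = {⟨0, by omega⟩, ⟨1, by omega⟩} := by
      ext l; simp [Fin.ext_iff]; omega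
    rw [this, LinearIndepOn.pair_iff _ (by simp)]
    intro s t hst
    have e0 := congrFun hst 0
    have e1 := congrFun hst 1
    simp only [Pi.add_apply, Pi.smul_apply, Matrix.col_apply, h0, h1, smul_eq_mul,
      Pi.zero_apply] at e0 e1
    simp only [wronskian, eval_sub, eval_mul] at hwx
    change s * eval (x : K) f + t * eval (x : K) (derivative f) = 0 at e0
    change s * eval (x : K) g + t * eval (x : K) (derivative g) = 0 at e1
    constructor
    · refine (mul_eq_zero.mp ?_).resolve_right hwx
      linear_combination (eval (x : K) (derivative g)) * e0 - (eval (x : K) (derivative f)) * e1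
    · refine (mul_eq_zero.mp ?_).resolve_right hwx
      linear_combination (eval (x : K) f) * e1 - (eval (x : K) g) * e0

section Compactness

variable (p : ℕ) [Fact p.Prime]

theorem exists_pos_le_norm_taylor_det (j : ℕ) {N : ℕ} (hN : 2 ≤ N) :
    ∃ c : ℝ, 0 < c ∧ ∀ b : Matrix (Fin j) (Fin N) ℚ_[p], (∀ i l, ‖b i l‖ ≤ 1) →
      (∃ σ : Fin j → Fin N, ‖(b.submatrix id σ).det‖ = 1) →
      ∃ x < 2 * N + 1, ∃ σ : Fin j → Fin N,
        (∀ l : Fin N, l.val < j → l.val < 2 → l ∈ Set.range σ) ∧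
        c ≤ ‖((b * taylorMatrix ℚ_[p] N x).submatrix id σ).det‖ := by
  classical
  let ι := {q : Fin (2 * N + 1) × (Fin j → Fin N) //
    ∀ l : Fin N, l.val < j → l.val < 2 → l ∈ Set.range q.2}
  let f : (Fin j → Fin N → ℚ_[p]) → ι → ℚ_[p] := fun b q =>
    ((Matrix.of b * taylorMatrix ℚ_[p] N (q.1.1.val : ℚ_[p])).submatrix id q.1.2).det
  let g : (Fin j → Fin N → ℚ_[p]) → (Fin j → Fin N) → ℚ_[p] := fun b σ =>
    ((Matrix.of b).submatrix id σ).det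
  have hf : Continuous f := continuous_pi fun q =>
    ((continuous_id.matrix_mul continuous_const).matrix_submatrix _ _).matrix_det
  have hg : Continuous g := continuous_pi fun σ =>
    (continuous_id.matrix_submatrix _ _).matrix_det
  have hK : IsCompact (Metric.closedBall (0 : Fin j → Fin N → ℚ_[p]) 1 ∩ {b | 1 ≤ ‖g b‖}) :=
    (isCompact_closedBall _ _).inter_right (isClosed_le continuous_const hg.norm)
  obtain ⟨c, hc, h⟩ := hK.exists_forall_le' (f := fun b => ‖f b‖) hf.norm.continuousOn (a := 0) (by
    rintro b ⟨-, hb⟩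
    obtain ⟨σ, hσ⟩ : ∃ σ, g b σ ≠ 0 := by
      by_contra! h
      have h0 : g b = 0 := funext h
      have : (1 : ℝ) ≤ ‖g b‖ := hb
      rw [h0, norm_zero] at this
      linarith
    have hrow : LinearIndependent ℚ_[p] (Matrix.of b).row := by
      have h1 := (Matrix.isUnit_iff_isUnit_det _).mpr hσ.isUnit
      rw [← Matrix.vecMul_injective_iff_isUnit] at h1
      rw [← Matrix.vecMul_injective_iff]
      intro u v huv
      refine h1 ?_
      ext i
      exact congrFun huv (σ i)
    obtain ⟨x, hx, τ, hτ, hdet⟩ := exists_taylor_det_ne_zero hN hrow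
    refine norm_pos_iff.mpr fun h0 => hdet ?_
    exact congrFun h0 ⟨(⟨x, hx⟩, τ), hτ⟩)
  refine ⟨c, hc, fun b hb ⟨σ, hσ⟩ => ?_⟩
  have hbK := h b ⟨by
    refine mem_closedBall_zero_iff.mpr ?_
    exact (pi_norm_le_iff_of_nonneg zero_le_one).mpr fun i =>
      (pi_norm_le_iff_of_nonneg zero_le_one).mpr (hb i), by
    show 1 ≤ ‖g b‖
    rw [← hσ]
    exact norm_le_pi_norm (g b) σ⟩
  by_contra! hlt
  refine absurd hbK (not_le.mpr ((pi_norm_lt_iff hc).mpr fun q => ?_))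
  exact hlt q.1.1 q.1.1.isLt q.1.2 q.2

end Compactness

section IntBasis

variable {j N : ℕ}

theorem exists_isIntBasis (V : Submodule ℚ (Fin N → ℚ)) :
    ∃ b : Matrix (Fin (Module.finrank ℚ V)) (Fin N) ℤ, IsIntBasis V b := by
  let φ : (Fin N → ℤ) →ₗ[ℤ] (Fin N → ℚ) := ((Int.castAddHom ℚ).compLeft (Fin N)).toIntLinearMap
  have hφ : Function.Injective φ := fun u v h => funext fun i => by
    have : (u i : ℚ) = v i := congrFun h i
    exact_mod_cast this
  let L : Submodule ℤ (Fin N → ℤ) := (V.restrictScalars ℤ).comap φ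
  let B := Module.finBasis ℤ L
  have hB : LinearIndependent ℤ fun i => (B i : Fin N → ℤ) :=
    B.linearIndependent.map' L.subtype L.ker_subtype
  have hφB : LinearIndependent ℚ fun i => φ (B i) := by
    rw [← LinearIndependent.iff_fractionRing (R := ℤ)]
    exact hB.map' φ (LinearMap.ker_eq_bot.mpr hφ)
  have hspan : Submodule.span ℚ (Set.range fun i => φ (B i)) = V := by
    refine le_antisymm ?_ fun w hw => ?_
    · rw [Submodule.span_le]
      rintro _ ⟨i, rfl⟩
      exact (B i).2
    · obtain ⟨d, hd⟩ := IsLocalization.exist_integer_multiples_of_finite (nonZeroDivisors ℤ) w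
      choose u hu using hd
      have hu' : φ u = ((d : ℤ) : ℚ) • w := by
        ext i
        have := hu i
        simp only [algebraMap_int_eq, eq_intCast, zsmul_eq_mul] at this
        exact this
      have huL : u ∈ L := by
        change φ u ∈ V
        rw [hu']
        exact V.smul_mem _ hw
      have hd0 : ((d : ℤ) : ℚ) ≠ 0 := by
        exact_mod_cast nonZeroDivisors.coe_ne_zero d
      have hw' : w = ((d : ℤ) : ℚ)⁻¹ • φ u := by
        rw [hu', inv_smul_smul₀ hd0]
      rw [hw']
      refine Submodule.smul_mem _ _ ?_
      have h1 : (⟨u, huL⟩ : L) = ∑ i, B.repr ⟨u, huL⟩ i • B i := (B.sum_repr _).symm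
      have h2 : φ u = ∑ i, B.repr ⟨u, huL⟩ i • φ (B i) := by
        have := congrArg (fun z : L => φ z) h1
        simpa only [AddSubmonoidClass.coe_finsetSum, SetLike.val_smul, map_sum, map_smul] using this
      rw [h2]
      refine Submodule.sum_mem _ fun i _ => ?_
      rw [← Int.cast_smul_eq_zsmul ℚ]
      exact Submodule.smul_mem _ _ (Submodule.subset_span ⟨i, rfl⟩)
  have hm : Module.finrank ℤ L = Module.finrank ℚ V := by
    have := finrank_span_eq_card hφB
    rw [hspan, Fintype.card_fin] at this
    exact this.symm
  rw [← hm]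
  refine ⟨Matrix.of fun i => (B i : Fin N → ℤ), hB, fun v => ⟨fun hv => ?_, ?_⟩⟩
  · refine ⟨B.repr ⟨v, hv⟩, ?_⟩
    have h1 := congrArg (fun z : L => (z : Fin N → ℤ)) (B.sum_repr ⟨v, hv⟩)
    simp only [AddSubmonoidClass.coe_finsetSum, SetLike.val_smul] at h1
    refine Eq.trans ?_ h1
    ext l
    simp [Matrix.vecMul, dotProduct, Finset.sum_apply]
  · rintro ⟨c, rfl⟩
    have : Matrix.vecMul c (Matrix.of fun i => (B i : Fin N → ℤ)) =
        ((∑ i, c i • B i : L) : Fin N → ℤ) := by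
      simp only [AddSubmonoidClass.coe_finsetSum, SetLike.val_smul]
      ext l
      simp [Matrix.vecMul, dotProduct, Finset.sum_apply]
    rw [this]
    exact (∑ i, c i • B i : L).2

theorem IsIntBasis.exists_not_dvd_det {V : Submodule ℚ (Fin N → ℚ)} {b : Matrix (Fin j) (Fin N) ℤ}
    (hb : IsIntBasis V b) (p : ℕ) [Fact p.Prime] :
    ∃ σ : Fin j → Fin N, ¬ (p : ℤ) ∣ (b.submatrix id σ).det := by
  have hrow : LinearIndependent (ZMod p) (b.map (Int.cast : ℤ → ZMod p)).row := by
    rw [← Matrix.vecMul_injective_iff, ← Matrix.coe_vecMulLinear, ← LinearMap.ker_eq_bot,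
      LinearMap.ker_eq_bot']
    intro c hc
    obtain ⟨c, rfl⟩ : ∃ c' : Fin j → ℤ, (fun i => (c' i : ZMod p)) = c :=
      ⟨fun i => (c i).cast, by ext i; simp⟩
    have hdvd : ∀ l, (p : ℤ) ∣ Matrix.vecMul c b l := by
      intro l
      rw [← ZMod.intCast_zmod_eq_zero_iff_dvd]
      have := congrFun hc l
      simpa [Matrix.vecMul, dotProduct] using this
    choose w hw using hdvd
    have hp0 : (p : ℚ) ≠ 0 := mod_cast (Fact.out : p.Prime).ne_zero
    have hwV : (fun i => (w i : ℚ)) ∈ V := by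
      have h1 : (fun i => ((Matrix.vecMul c b i : ℤ) : ℚ)) ∈ V := (hb.mem_iff _).mpr ⟨c, rfl⟩
      have h2 : (fun i => (w i : ℚ)) = (p : ℚ)⁻¹ • fun i => ((Matrix.vecMul c b i : ℤ) : ℚ) := by
        rw [eq_inv_smul_iff₀ hp0]
        ext i
        simp [hw]
      rw [h2]
      exact V.smul_mem _ h1
    obtain ⟨d, hd⟩ := (hb.mem_iff w).mp hwV
    have h0 := Fintype.linearIndependent_iff.mp hb.linearIndependent (c - (p : ℤ) • d) (by
      ext l
      have h1 := hw l
      rw [← hd] at h1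
      simp only [Matrix.vecMul, dotProduct] at h1
      simp only [Finset.sum_apply, Pi.smul_apply, Pi.sub_apply, smul_eq_mul, sub_mul,
        Finset.sum_sub_distrib, h1, Finset.mul_sum, mul_assoc, Pi.zero_apply, sub_self])
    ext i
    have := h0 i
    simp only [Pi.sub_apply, Pi.smul_apply, smul_eq_mul, sub_eq_zero] at this
    simp [this]
  obtain ⟨σ, -, hσ⟩ := exists_det_submatrix_ne_zero hrow (s := ∅) (by simp)
  refine ⟨σ, fun hdvd => hσ ?_⟩
  rw [← ZMod.intCast_zmod_eq_zero_iff_dvd] at hdvd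
  rw [← hdvd, Int.cast_det]
  rfl

theorem IsIntBasis.one_le_archSize {V : Submodule ℚ (Fin N → ℚ)} {b : Matrix (Fin j) (Fin N) ℤ}
    (hb : IsIntBasis V b) : 1 ≤ archSize b := by
  obtain ⟨σ, hσ⟩ := hb.exists_not_dvd_det 2
  have h0 : (b.submatrix id σ).det ≠ 0 := fun h => hσ (h ▸ dvd_zero _)
  refine le_trans ?_ (norm_le_pi_norm (fun σ : Fin j → Fin N => (b.submatrix id σ).det) σ)
  rw [Int.norm_eq_abs]
  exact_mod_cast Int.one_le_abs h0

end IntBasis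

section LowerBound

variable {p k j N : ℕ} [Fact p.Prime]

theorem pow_le_pow_sum_closeExp (hN : 3 ≤ N) (hj : j ≤ N) {T : ℝ} (hT1 : 1 ≤ T)
    (hT : T ^ N = (p : ℝ) ^ (3 * k)) {σ : Fin j → Fin N}
    (hσ : ∀ l : Fin N, l.val < j → l.val < 2 → l ∈ Set.range σ) :
    T ^ j ≤ (p : ℝ) ^ (∑ i, closeExp k (σ i)) := by
  have hp1 : 1 ≤ (p : ℝ) := mod_cast (Fact.out : p.Prime).one_lt.le
  rcases j with - | - | j
  · simp
  · obtain ⟨i, hi⟩ := hσ ⟨0, by omega⟩ (by simp) (by simp)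
    have h1 : closeExp k (σ i) = 2 * k := by rw [hi]; rfl
    have h2 : 2 * k ≤ ∑ i, closeExp k (σ i) := by
      rw [← h1]; exact Finset.single_le_sum (f := fun i => closeExp k (σ i))
        (fun _ _ => Nat.zero_le _) (Finset.mem_univ i)
    have h3 : T ≤ (p : ℝ) ^ (2 * k) := by
      rw [← pow_le_pow_iff_left₀ (by linarith) (by positivity) (show N ≠ 0 by omega), hT, ← pow_mul]
      refine pow_le_pow_right₀ hp1 ?_
      nlinarith
    simpa only [zero_add, pow_one] using h3.trans (pow_le_pow_right₀ hp1 h2)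
  · obtain ⟨i, hi⟩ := hσ ⟨0, by omega⟩ (by simp) (by simp)
    obtain ⟨l, hl⟩ := hσ ⟨1, by omega⟩ (by simp) (by simp)
    have hil : i ≠ l := by
      rintro rfl
      rw [hi] at hl
      simp at hl
    have h1 : closeExp k (σ i) = 2 * k := by rw [hi]; rfl
    have h1' : closeExp k (σ l) = k := by rw [hl]; rfl
    have h2 : 3 * k ≤ ∑ i, closeExp k (σ i) := by
      have h3 := Finset.sum_le_sum_of_subset (f := fun i => closeExp k (σ i))
        (Finset.subset_univ {i, l})
      rw [Finset.sum_pair hil, h1, h1'] at h3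
      omega
    exact (pow_le_pow_right₀ hT1 hj).trans (hT.le.trans (pow_le_pow_right₀ hp1 h2))

theorem exists_pos_le_archSize_mul_padicSize (p : ℕ) [Fact p.Prime] (hN : 3 ≤ N) :
    ∃ ρ : ℝ, 0 < ρ ∧ ρ ≤ 1 ∧ ∀ (k : ℕ) (T : ℝ), 1 ≤ T → T ^ N = (p : ℝ) ^ (3 * k) →
      ∀ j ≤ N, ∀ (V : Submodule ℚ (Fin N → ℚ)) (b : Matrix (Fin j) (Fin N) ℤ), IsIntBasis V b →
        ∃ x : ℕ, ρ * T ^ j ≤ archSize b * padicSize p k x b := by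
  choose c hc0 hc using fun j => exists_pos_le_norm_taylor_det p j (show 2 ≤ N by omega)
  have hne : (Finset.range (N + 1)).Nonempty := ⟨0, by simp⟩
  refine ⟨min 1 ((Finset.range (N + 1)).inf' hne c), lt_min one_pos
    ((Finset.lt_inf'_iff _).mpr fun j _ => hc0 j), min_le_left _ _,
    fun k T hT1 hT j hj V b hb => ?_⟩
  obtain ⟨τ, hτ⟩ := hb.exists_not_dvd_det p
  have hmap : ∀ M : Matrix (Fin j) (Fin j) ℤ, ((M.det : ℤ) : ℚ_[p]) = (M.map Int.cast).det :=
    fun M => Int.cast_det M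
  let B : Matrix (Fin j) (Fin N) ℚ_[p] := b.map Int.cast
  obtain ⟨x, -, σ, hσ, hdet⟩ := hc j B (fun i l => Padic.norm_int_le_one _) ⟨τ, by
    have h1 : ‖((b.submatrix id τ).det : ℚ_[p])‖ = 1 :=
      le_antisymm (Padic.norm_int_le_one _) (not_lt.mp fun h =>
        hτ (Padic.norm_intCast_lt_one_iff.mp h))
    rw [← h1, hmap]
    rfl⟩
  refine ⟨x, ?_⟩
  have h2 : ((B * taylorMatrix ℚ_[p] N (x : ℚ_[p])).submatrix id σ).det =
      (taylorMinor (x : ℤ) b σ : ℚ_[p]) := by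
    rw [taylorMinor, hmap]
    congr 1
    ext i l
    simp [Matrix.mul_apply, taylorMatrix, B]
  rw [h2] at hdet
  have h3 := le_padicSize (p := p) (k := k) (x : ℤ) b σ
  have h4 : T ^ j ≤ (p : ℝ) ^ (∑ i, closeExp k (σ i)) := pow_le_pow_sum_closeExp hN hj hT1 hT hσ
  calc _ ≤ c j * T ^ j := by
        gcongr
        exact (min_le_right _ _).trans (Finset.inf'_le _ (Finset.mem_range.mpr (by omega)))
    _ ≤ ‖(taylorMinor (x : ℤ) b σ : ℚ_[p])‖ * (p : ℝ) ^ (∑ i, closeExp k (σ i)) := by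
        gcongr
    _ ≤ padicSize p k (x : ℤ) b := by rw [mul_comm]; exact h3
    _ ≤ _ := le_mul_of_one_le_left (zero_le_one.trans (one_le_padicSize _ _)) hb.one_le_archSize

end LowerBound

theorem IsChain.card_le_finrank_add_one {K E : Type*} [DivisionRing K] [AddCommGroup E] [Module K E]
    [FiniteDimensional K E] {F : Finset (Submodule K E)}
    (hF : IsChain (· ≤ ·) (F : Set (Submodule K E))) : F.card ≤ Module.finrank K E + 1 := by
  rw [← Finset.card_range (Module.finrank K E + 1)]
  refine Finset.card_le_card_of_injOn (fun V => Module.finrank K V)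
    (fun V _ => by simpa [Nat.lt_succ_iff] using V.finrank_le) fun V hV W hW hVW => ?_
  rcases hF.total hV hW with h | h
  · exact Submodule.eq_of_le_of_finrank_eq h hVW
  · exact (Submodule.eq_of_le_of_finrank_eq h hVW.symm).symm

section ShortVectors

variable {p k N : ℕ} [Fact p.Prime]

theorem archSize_mul_padicSize_le_one {j : ℕ} (hj : j = 0) (x : ℤ) (b : Matrix (Fin j) (Fin N) ℤ) :
    archSize b * padicSize p k x b ≤ 1 := by
  subst hj
  have h1 : archSize b ≤ 1 := (pi_norm_le_iff_of_nonneg zero_le_one).mpr fun σ => by simp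
  have h2 : padicSize p k x b ≤ 1 := padicSize_le le_rfl fun σ => by simp [taylorMinor]
  exact mul_le_one₀ h1 (zero_le_one.trans (one_le_padicSize _ _)) h2

theorem archSize_mul_padicSize_le_of_eq {V W : Submodule ℚ (Fin N → ℚ)} {j j' : ℕ} (hj : j' = j + 1)
    {b : Matrix (Fin j) (Fin N) ℤ} {b' : Matrix (Fin j') (Fin N) ℤ} (hb : IsIntBasis V b)
    (hb' : IsIntBasis W b') (hVW : V ≤ W) {x : ℤ} {v : Fin N → ℤ} (hv : IsClose p k x v)
    (hvV : (fun i => (v i : ℚ)) ∉ V) (hvW : (fun i => (v i : ℚ)) ∈ W) :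
    archSize b' * padicSize p k x b' ≤ (j + 1) * ‖v‖ * (archSize b * padicSize p k x b) := by
  subst hj
  exact archSize_mul_padicSize_le hb hb' hVW hv hvV hvW

/-- The normalised size of the lattice of integer vectors in a rational subspace. -/
noncomputable def subspaceSize (p k : ℕ) [Fact p.Prime] (T : ℝ) (V : Submodule ℚ (Fin N → ℚ))
    (x : ℕ) : ℝ :=
  archSize (exists_isIntBasis V).choose / T ^ Module.finrank ℚ V *
    padicSize p k (x : ℤ) (exists_isIntBasis V).choose

theorem le_norm_of_flagMarked {T ε : ℝ} (hT : 0 < T) {x : ℕ}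
    (h : FlagMarked (subspaceSize (N := N) p k T) Set.univ ε x) {v : Fin N → ℤ}
    (hv : IsClose p k x v) (hv0 : v ≠ 0) : ε / N * T ≤ ‖v‖ := by
  obtain ⟨F, -, hF, hlt, hge⟩ := h
  set w : Fin N → ℚ := fun i => (v i : ℚ)
  have hw0 : w ≠ 0 := fun h => hv0 (funext fun i => by
    have : (v i : ℚ) = 0 := congrFun h i
    exact_mod_cast this)
  have hF' : IsChain (· ≤ ·) (insert ⊥ F) := hF.insert fun V _ _ => Or.inl bot_le
  obtain ⟨V, ⟨hVF, hwV⟩, hmax⟩ := wellFounded_gt.has_min {V | V ∈ insert ⊥ F ∧ w ∉ V}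
    ⟨⊥, by simp, by simpa using hw0⟩
  have hV1 : subspaceSize p k T V x ≤ 1 := by
    rcases hVF with rfl | hVF
    · have := archSize_mul_padicSize_le_one (p := p) (k := k) (finrank_bot ℚ (Fin N → ℚ)) (x : ℤ)
        (exists_isIntBasis (⊥ : Submodule ℚ (Fin N → ℚ))).choose
      simpa [subspaceSize] using this
    · exact (hlt V hVF).le
  have hrank := Submodule.finrank_sup_span_singleton hwV
  have hW := hge (V ⊔ ℚ ∙ w) (Set.mem_univ _) fun U hU => by
    by_cases hwU : w ∈ U
    · refine Or.inr (sup_le ?_ ((Submodule.span_singleton_le_iff_mem _ _).mpr hwU))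
      exact (hF'.total hVF (Set.mem_insert_of_mem _ hU)).resolve_right fun h => hwV (h hwU)
    · refine Or.inl (le_trans ?_ le_sup_left)
      rcases hF'.total hVF (Set.mem_insert_of_mem _ hU) with h | h
      · exact (h.eq_of_not_lt (hmax U ⟨Set.mem_insert_of_mem _ hU, hwU⟩)).ge
      · exact h
  have hle := archSize_mul_padicSize_le_of_eq hrank (exists_isIntBasis V).choose_spec
    (exists_isIntBasis (V ⊔ ℚ ∙ w)).choose_spec le_sup_left hv hwV
    (Submodule.mem_sup_right (Submodule.mem_span_singleton_self w))
  have hN : Module.finrank ℚ V + 1 ≤ N := by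
    rw [← hrank]
    simpa using (V ⊔ ℚ ∙ w).finrank_le
  rw [subspaceSize, div_mul_eq_mul_div, div_le_one (by positivity)] at hV1
  rw [subspaceSize, div_mul_eq_mul_div, le_div_iff₀ (by positivity)] at hW
  have hN' : ((Module.finrank ℚ V : ℝ) + 1) ≤ N := by exact_mod_cast hN
  have hN0 : (0 : ℝ) < N := by linarith [(Nat.cast_nonneg (Module.finrank ℚ V) : (0:ℝ) ≤ _)]
  have h1 : ε * T ^ (Module.finrank ℚ V + 1) ≤ N * ‖v‖ * T ^ Module.finrank ℚ V := by
    rw [← hrank]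
    exact hW.trans (hle.trans (mul_le_mul (by gcongr) hV1
      (mul_nonneg (archSize_nonneg _) (zero_le_one.trans (one_le_padicSize _ _))) (by positivity)))
  have h2 : ε * T ≤ N * ‖v‖ := by
    rw [pow_succ, ← mul_assoc, mul_right_comm] at h1
    exact le_of_mul_le_mul_right h1 (by positivity)
  rw [div_mul_eq_mul_div, div_le_iff₀ hN0]
  linarith

open Classical in
theorem exists_pos_half_le_card (p : ℕ) [Fact p.Prime] (hN : 3 ≤ N) :
    ∃ δ : ℝ, 0 < δ ∧ ∀ (k : ℕ) (T : ℝ), 1 ≤ T → T ^ N = (p : ℝ) ^ (3 * k) →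
      (p : ℝ) ^ k ≤ 2 * (((Finset.range (p ^ k)).filter fun a => ∃ x : ℕ, x % p ^ k = a ∧
        ∀ v : Fin N → ℤ, v ≠ 0 → IsClose p k x v → δ * T ≤ ‖v‖).card : ℝ) := by
  have hp : 1 < p := (Fact.out : p.Prime).one_lt
  have hp0 : 0 < (p : ℝ) := by positivity
  obtain ⟨ρ, hρ0, hρ1, hρ⟩ := exists_pos_le_archSize_mul_padicSize p hN
  obtain ⟨m, hm⟩ := pow_unbounded_of_one_lt (N * N * p + 2 * (N + 2) * (N * N)) hp
  set D := N * N
  set η : ℝ := ((p : ℝ) ^ (m * D))⁻¹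
  have hη0 : 0 < η := by positivity
  have hη1 : η ≤ 1 := inv_le_one_of_one_le₀ (one_le_pow₀ (by exact_mod_cast hp.le))
  set ε := η ^ (N + 2) * ρ
  have hN0 : (0 : ℝ) < N := by exact_mod_cast (by omega : 0 < N)
  refine ⟨ε / N, by positivity, fun k T hT1 hT => ?_⟩
  have hT0 : 0 < T := by linarith
  have hpoly : ∀ V : Submodule ℚ (Fin N → ℚ), IsPadicPolyMax p D (subspaceSize p k T V) :=
    fun V => isPadicPolyMax_padicSize (by simpa using V.finrank_le) _
      (div_nonneg (archSize_nonneg _) (by positivity))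
  have hcard := card_not_flagMarked_le (subspaceSize (N := N) p k T) (K := 2 * k * N + m)
    (k₀ := 2 * k * N) (θ := D / (p : ℝ) ^ m) (by omega) hη0 hη1 (by positivity)
    (by
      intro V x y hxy
      have hV : Module.finrank ℚ V ≤ N := by simpa using V.finrank_le
      have h1 := Nat.modEq_iff_dvd.mp hxy
      push_cast at h1
      unfold subspaceSize
      congr 1
      refine le_antisymm ?_ ?_
      · exact padicSize_le_of_modEq hV _ (by rwa [dvd_sub_comm])
      · exact padicSize_le_of_modEq hV _ h1)
    (by
      intro V s a x₀ hs hx₀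
      have h1 := (hpoly V).card_lt_le (K := 2 * k * N + m) (m := m) (by omega) hx₀
      rw [card_residueBall (by omega) (by omega) (hx₀ ▸ Nat.mod_lt _ (by positivity))]
      refine (Nat.cast_le.mpr h1).trans (le_of_eq ?_)
      push_cast
      rw [show 2 * k * N + m - s = (2 * k * N + m - (s + m)) + m by omega, pow_add]
      field_simp)
    (fun V s c x₀ hs hc hx₀ => (hpoly V).exists_child (by nlinarith) hc hx₀) (N + 1)
    Set.univ (fun F _ hF => by simpa using hF.card_le_finrank_add_one) ρ hρ0 hρ1 0 0 (Nat.zero_le _)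
    (by
      intro V _
      obtain ⟨x, hx⟩ := hρ k T hT1 hT _ (by simpa using V.finrank_le) V _
        (exists_isIntBasis V).choose_spec
      refine ⟨x, by simp [Nat.mod_one], ?_⟩
      rw [subspaceSize, div_mul_eq_mul_div, le_div_iff₀ (by positivity)]
      exact hx)
  set B := residueBall p (2 * k * N + m) 0 0
  have hB : (B.card : ℝ) = (p : ℝ) ^ (2 * k * N + m) := by
    rw [card_residueBall (by omega) (by omega) (by simp)]
    simp
  have hθ : ((N + 1 : ℕ) : ℝ) * (D / (p : ℝ) ^ m) ≤ 1 / 2 := by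
    rw [mul_div, div_le_div_iff₀ (by positivity) two_pos]
    have : (N + 1) * D * 2 ≤ 1 * p ^ m := by nlinarith
    exact_mod_cast this
  set G := B.filter fun x => FlagMarked (subspaceSize (N := N) p k T) Set.univ ε x
  have hsum := Finset.card_filter_add_card_filter_not (s := B)
    (fun x => FlagMarked (subspaceSize (N := N) p k T) Set.univ ε x)
  have hG : (p : ℝ) ^ (2 * k * N + m) ≤ 2 * G.card := by
    have h1 : (G.card : ℝ) + ((B.filter fun x =>
        ¬ FlagMarked (subspaceSize (N := N) p k T) Set.univ ε x).card : ℝ) = B.card := by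
      exact_mod_cast hsum
    have h2 : ((N + 1 : ℕ) : ℝ) * (D / (p : ℝ) ^ m) * B.card ≤ 1 / 2 * B.card := by gcongr
    have h3 := hcard.trans h2
    rw [← hB]
    linarith
  have hkK : k ≤ 2 * k * N + m := by nlinarith
  set A := (Finset.range (p ^ k)).filter fun a => ∃ x : ℕ, x % p ^ k = a ∧
        ∀ v : Fin N → ℤ, v ≠ 0 → IsClose p k x v → ε / N * T ≤ ‖v‖
  have hA : G.card ≤ p ^ (2 * k * N + m - k) * A.card := by
    refine (Finset.card_le_mul_card_image (f := (· % p ^ k)) G (p ^ (2 * k * N + m - k))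
      fun a ha => ?_).trans (Nat.mul_le_mul_left _ (Finset.card_le_card fun a ha => ?_))
    · obtain ⟨x, -, hx⟩ := Finset.mem_image.mp ha
      rw [← card_residueBall (by omega) hkK (hx ▸ Nat.mod_lt _ (by positivity))]
      refine Finset.card_le_card fun y hy => ?_
      rw [Finset.mem_filter] at hy
      exact mem_residueBall.mpr
        ⟨(mem_residueBall.mp (Finset.mem_filter.mp hy.1).1).1, hy.2⟩
    · obtain ⟨x, hxG, rfl⟩ := Finset.mem_image.mp ha
      exact Finset.mem_filter.mpr ⟨Finset.mem_range.mpr (Nat.mod_lt _ (by positivity)), x, rfl,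
        fun v hv0 hv => le_norm_of_flagMarked hT0 (Finset.mem_filter.mp hxG).2 hv hv0⟩
  have hA' : (G.card : ℝ) ≤ (p : ℝ) ^ (2 * k * N + m - k) * A.card := by exact_mod_cast hA
  have hpow : (p : ℝ) ^ (2 * k * N + m) = (p : ℝ) ^ (2 * k * N + m - k) * (p : ℝ) ^ k := by
    rw [← pow_add, Nat.sub_add_cancel hkK]
  rw [hpow] at hG
  have hpos : 0 < (p : ℝ) ^ (2 * k * N + m - k) := by positivity
  refine le_of_mul_le_mul_left ?_ hpos
  linarith

end ShortVectors

section SpanningVectors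

variable {p k N : ℕ}

theorem isClose_iff (hN : 2 ≤ N) {x : ℤ} {v : Fin N → ℤ} :
    IsClose p k x v ↔ (p : ℤ) ^ (2 * k) ∣ (polyOfCoeffs v).eval x ∧
      (p : ℤ) ^ k ∣ (derivative (polyOfCoeffs v)).eval x := by
  rw [← vecMul_taylorMatrix_zero v x (by omega : 0 < N),
    ← vecMul_taylorMatrix_one v x (by omega : 1 < N)]
  refine ⟨fun h => ⟨by simpa [closeExp] using h ⟨0, by omega⟩,
    by simpa [closeExp] using h ⟨1, by omega⟩⟩, fun h l => ?_⟩
  obtain ⟨l, hl⟩ := l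
  rcases l with - | - | l
  · simpa [closeExp] using h.1
  · simpa [closeExp] using h.2
  · simp [closeExp]

theorem exists_isClose_of_card_lt [Fact p.Prime] (hN : 2 ≤ N) (x : ℤ) (i₀ : Fin N) {H : ℕ} {s : ℝ}
    (hs : 0 < s) (hH : p ^ (3 * k) * (⌊H / s⌋₊ + 1) ^ (N - 1) < (H + 1) ^ N) :
    ∃ v : Fin N → ℤ, v ≠ 0 ∧ IsClose p k x v ∧ ‖v‖ ≤ H ∧ ∀ i ≠ i₀, ‖v i‖ < s := by
  have hp : p ≠ 0 := (Fact.out : p.Prime).ne_zero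
  have : NeZero (p ^ (2 * k)) := ⟨pow_ne_zero _ hp⟩
  have : NeZero (p ^ k) := ⟨pow_ne_zero _ hp⟩
  set L := ⌊H / s⌋₊
  let w : (Fin N → Fin (H + 1)) → Fin N → ℤ := fun u i => (u i : ℤ)
  let c : Fin (H + 1) → Fin (L + 1) := fun a => ⟨⌊a / s⌋₊, by
    have ha : (a : ℝ) ≤ H := mod_cast Nat.lt_succ_iff.mp a.isLt
    exact Nat.lt_succ_iff.mpr (Nat.floor_le_floor (by gcongr))⟩
  let φ : (Fin N → Fin (H + 1)) →
      ZMod (p ^ (2 * k)) × ZMod (p ^ k) × ({i // i ≠ i₀} → Fin (L + 1)) := fun u =>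
    (((polyOfCoeffs (w u)).eval x : ℤ), ((derivative (polyOfCoeffs (w u))).eval x : ℤ),
      fun i => c (u i))
  obtain ⟨u, u', hne, heq⟩ := Fintype.exists_ne_map_eq_of_card_lt φ (by
    simp only [Fintype.card_prod, ZMod.card, Fintype.card_fin,
      Fintype.card_subtype_compl, Fintype.card_unique, ← mul_assoc, ← pow_add, Fintype.card_fun]
    convert hH using 3
    ring)
  simp only [φ, Prod.mk.injEq] at heq
  obtain ⟨h0, h1, h2⟩ := heq
  have hsub : polyOfCoeffs (w u - w u') = polyOfCoeffs (w u) - polyOfCoeffs (w u') := by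
    simp [polyOfCoeffs, Finset.sum_sub_distrib]
  refine ⟨w u - w u', ?_, ?_, ?_, fun i hi => ?_⟩
  · rw [sub_ne_zero]
    intro h
    exact hne (funext fun i => Fin.ext (by simpa [w] using congrFun h i))
  · rw [isClose_iff hN, hsub, derivative_sub, eval_sub, eval_sub]
    rw [eq_comm, ZMod.intCast_eq_intCast_iff_dvd_sub] at h0 h1
    exact ⟨by exact_mod_cast h0, by exact_mod_cast h1⟩
  · refine (pi_norm_le_iff_of_nonneg (by positivity)).mpr fun i => ?_
    have h3 := (u i).isLt
    have h4 := (u' i).isLt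
    have : |(u i : ℤ) - (u' i : ℤ)| ≤ H := by rw [abs_le]; omega
    simpa [w, Int.norm_eq_abs] using (mod_cast this : |((u i : ℕ) : ℝ) - ((u' i : ℕ) : ℝ)| ≤ H)
  · have h3 : ⌊(u i : ℝ) / s⌋₊ = ⌊(u' i : ℝ) / s⌋₊ := by
      simpa [c] using congrFun h2 ⟨i, hi⟩
    have h4 := Nat.floor_le (div_nonneg (Nat.cast_nonneg (u i).val) hs.le)
    have h5 := Nat.floor_le (div_nonneg (Nat.cast_nonneg (u' i).val) hs.le)
    have h6 := Nat.lt_floor_add_one ((u i : ℝ) / s)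
    have h7 := Nat.lt_floor_add_one ((u' i : ℝ) / s)
    rw [h3] at h4 h6
    have h8 : |(u i : ℝ) / s - (u' i : ℝ) / s| < 1 := by rw [abs_lt]; constructor <;> linarith
    rw [← sub_div, abs_div, abs_of_pos hs, div_lt_one hs] at h8
    simpa [w, Int.norm_eq_abs] using h8

theorem span_isClose_eq_top [Fact p.Prime] (hN : 2 ≤ N) {δ T : ℝ} (hδ : 0 < δ) (hT : 1 ≤ T)
    (hTN : T ^ N = (p : ℝ) ^ (3 * k)) {x : ℤ}
    (hx : ∀ v : Fin N → ℤ, v ≠ 0 → IsClose p k x v → δ * T ≤ ‖v‖) :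
    Submodule.span ℚ {w : Fin N → ℚ | ∃ v : Fin N → ℤ, IsClose p k x v ∧
      ‖v‖ ≤ (N / δ + 1) ^ N * T ∧ w = fun i => (v i : ℚ)} = ⊤ := by
  by_contra hspan
  obtain ⟨f, hf0, hf⟩ := Submodule.exists_le_ker_of_lt_top _ (lt_top_iff_ne_top.mpr hspan)
  have : Nonempty (Fin N) := ⟨⟨0, by omega⟩⟩
  obtain ⟨i₀, hi₀⟩ := Finite.exists_max fun i : Fin N => |f (Pi.single i 1)|
  have hsum : ∀ w : Fin N → ℚ, f w = ∑ i, w i * f (Pi.single i 1) := fun w => by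
    rw [LinearMap.pi_apply_eq_sum_univ f w]
    refine Finset.sum_congr rfl fun i _ => ?_
    rw [smul_eq_mul]
    congr 2
    ext j
    simp [Pi.single_apply, eq_comm]
  have ha : 0 < |f (Pi.single i₀ 1)| := by
    refine abs_pos.mpr fun h => hf0 (LinearMap.ext fun w => ?_)
    rw [hsum]
    refine Finset.sum_eq_zero fun i _ => ?_
    have := hi₀ i
    rw [h, abs_zero, abs_nonpos_iff] at this
    rw [this, mul_zero]
  have hker : ∀ w : Fin N → ℚ, f w = 0 → |w i₀| ≤ ∑ i ∈ Finset.univ.erase i₀, |w i| := by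
    intro w hw
    rw [hsum, ← Finset.add_sum_erase _ _ (Finset.mem_univ i₀), add_eq_zero_iff_eq_neg] at hw
    refine le_of_mul_le_mul_right ?_ ha
    rw [← abs_mul, hw, abs_neg, Finset.sum_mul]
    refine (Finset.abs_sum_le_sum_abs _ _).trans (Finset.sum_le_sum fun i _ => ?_)
    rw [abs_mul]
    exact mul_le_mul_of_nonneg_left (hi₀ i) (abs_nonneg _)
  have hN0 : (0 : ℝ) < N := by positivity
  set r := N / δ + 1 with hr
  have hr1 : 1 ≤ r := by rw [hr]; linarith [div_pos hN0 hδ]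
  set C := r ^ N with hC
  have hC1 : 1 ≤ C := one_le_pow₀ hr1
  have hT0 : 0 < T := by linarith
  set s := δ * T / N with hs
  have hs0 : 0 < s := by positivity
  have hHle : (⌊C * T⌋₊ : ℝ) ≤ C * T := Nat.floor_le (by positivity)
  obtain ⟨v, hv0, hv, hvn, hvi⟩ := exists_isClose_of_card_lt (k := k) hN x i₀ (H := ⌊C * T⌋₊) hs0 (by
    have h1 : (⌊(⌊C * T⌋₊ : ℝ) / s⌋₊ : ℝ) + 1 ≤ C * r := by
      calc (⌊(⌊C * T⌋₊ : ℝ) / s⌋₊ : ℝ) + 1 ≤ C * T / s + 1 := by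
            gcongr
            refine (Nat.floor_le (by positivity)).trans (by gcongr)
        _ = C * (N / δ) + 1 := by rw [hs]; field_simp
        _ ≤ C * r := by rw [hr]; linarith
    have h2 : (p : ℝ) ^ (3 * k) * ((⌊(⌊C * T⌋₊ : ℝ) / s⌋₊ : ℝ) + 1) ^ (N - 1) <
        ((⌊C * T⌋₊ : ℝ) + 1) ^ N := by
      calc (p : ℝ) ^ (3 * k) * ((⌊(⌊C * T⌋₊ : ℝ) / s⌋₊ : ℝ) + 1) ^ (N - 1)
          ≤ T ^ N * (C * r) ^ (N - 1) := by rw [hTN]; gcongr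
        _ ≤ T ^ N * (C ^ (N - 1) * C) := by
            rw [mul_pow]
            gcongr
            exact pow_le_pow_right₀ hr1 (by omega)
        _ = (C * T) ^ N := by
            rw [← pow_succ, Nat.sub_add_cancel (by omega), mul_pow, mul_comm]
        _ < ((⌊C * T⌋₊ : ℝ) + 1) ^ N := by
            gcongr
            exact Nat.lt_floor_add_one _
    exact_mod_cast h2)
  have h0 : |(v i₀ : ℚ)| ≤ ∑ i ∈ Finset.univ.erase i₀, |(v i : ℚ)| :=
    hker (fun i => (v i : ℚ)) (hf (Submodule.subset_span ⟨v, hv, hvn.trans hHle, rfl⟩))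
  have h1 : ‖v i₀‖ ≤ ∑ i ∈ Finset.univ.erase i₀, ‖v i‖ := by
    simp only [Int.norm_eq_abs]
    exact_mod_cast h0
  have h2 : ‖v‖ ≤ (N - 1) * s := by
    have hone : (1 : ℝ) ≤ N - 1 := by
      have : (2 : ℝ) ≤ N := mod_cast hN
      linarith
    refine (pi_norm_le_iff_of_nonneg (by positivity)).mpr fun i => ?_
    by_cases hi : i = i₀
    · rw [hi]
      refine h1.trans ((Finset.sum_le_card_nsmul _ _ s fun i hi =>
        (hvi i (Finset.ne_of_mem_erase hi)).le).trans ?_)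
      rw [Finset.card_erase_of_mem (Finset.mem_univ _), Finset.card_univ, Fintype.card_fin,
        nsmul_eq_mul, Nat.cast_sub (by omega), Nat.cast_one]
    · exact (hvi i hi).le.trans (le_mul_of_one_le_left hs0.le hone)
  have h3 : δ * T = N * s := by rw [hs]; field_simp
  linarith [hx v hv0 hv]

/-- Every integer vector is close to `m` times a short combination of close vectors. -/
theorem exists_isClose_norm_sub_le [Fact p.Prime] (hN : 2 ≤ N) {δ T : ℝ} (hδ : 0 < δ) (hT : 1 ≤ T)
    (hTN : T ^ N = (p : ℝ) ^ (3 * k)) {x : ℤ}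
    (hx : ∀ v : Fin N → ℤ, v ≠ 0 → IsClose p k x v → δ * T ≤ ‖v‖) (m : ℕ) (hm : 0 < m)
    (w : Fin N → ℤ) :
    ∃ v : Fin N → ℤ, IsClose p k x v ∧ ‖w - (m : ℤ) • v‖ ≤ m * (N * ((N / δ + 1) ^ N * T)) := by
  set S := {w : Fin N → ℚ | ∃ v : Fin N → ℤ, IsClose p k x v ∧
      ‖v‖ ≤ (N / δ + 1) ^ N * T ∧ w = fun i => (v i : ℚ)} with hS
  obtain ⟨b, hbS, hbspan, hb⟩ := exists_linearIndependent ℚ S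
  rw [span_isClose_eq_top hN hδ hT hTN hx] at hbspan
  have hbf : Finite b := hb.finite
  have := Fintype.ofFinite b
  have hcard : Fintype.card b = N := by
    have := finrank_span_eq_card hb
    rw [Subtype.range_coe, hbspan, finrank_top] at this
    simpa using this.symm
  choose v hvc hvn hv using fun e : b => hbS e.2
  have hmem : (fun i => (w i : ℚ)) ∈ Submodule.span ℚ (Set.range ((↑) : b → Fin N → ℚ)) := by
    rw [Subtype.range_coe, hbspan]; trivial
  obtain ⟨c, hc⟩ := (Submodule.mem_span_range_iff_exists_fun ℚ).mp hmem
  refine ⟨∑ e, round (c e / m) • v e, fun l => ?_, ?_⟩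
  · rw [Matrix.sum_vecMul, Finset.sum_apply]
    refine Finset.dvd_sum fun e _ => ?_
    rw [Matrix.smul_vecMul, Pi.smul_apply, smul_eq_mul]
    exact (hvc e l).mul_left _
  · have hm' : (m : ℚ) ≠ 0 := by positivity
    refine (pi_norm_le_iff_of_nonneg (by positivity)).mpr fun i => ?_
    have key : ((w - (m : ℤ) • ∑ e, round (c e / m) • v e) i : ℚ) =
        m * ∑ e, (c e / m - round (c e / m)) * v e i := by
      have h1 := congrFun hc i
      simp only [Finset.sum_apply, Pi.smul_apply, smul_eq_mul] at h1
      simp only [Pi.sub_apply, Pi.smul_apply, Finset.sum_apply, smul_eq_mul, sub_mul,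
        Finset.sum_sub_distrib, mul_sub, Int.cast_sub, Int.cast_mul, Int.cast_sum, Int.cast_natCast]
      congr 1
      rw [← h1, Finset.mul_sum]
      refine Finset.sum_congr rfl fun e _ => ?_
      rw [hv e]
      field_simp
    have hkey := congrArg (fun q : ℚ => (q : ℝ)) key
    simp only [Rat.cast_intCast, Rat.cast_mul, Rat.cast_sum, Rat.cast_natCast] at hkey
    rw [Int.norm_eq_abs, hkey, abs_mul, Nat.abs_cast]
    gcongr
    refine (Finset.abs_sum_le_sum_abs _ _).trans ((Finset.sum_le_card_nsmul _ _
      ((N / δ + 1) ^ N * T) fun e _ => ?_).trans ?_)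
    · rw [abs_mul]
      have h2 : |((c e / m - round (c e / m) : ℚ) : ℝ)| ≤ 1 := by
        have := abs_sub_round (c e / m)
        have : |c e / m - round (c e / m)| ≤ 1 := this.trans (by norm_num)
        exact_mod_cast this
      have h3 : |(v e i : ℝ)| ≤ (N / δ + 1) ^ N * T := by
        rw [← Int.norm_eq_abs]
        exact (norm_le_pi_norm (v e) i).trans (hvn e)
      calc _ ≤ 1 * ((N / δ + 1) ^ N * T) := by gcongr
        _ = _ := one_mul _
    · rw [Finset.card_univ, hcard, nsmul_eq_mul]

end SpanningVectors

theorem exists_root_norm_sub_le {L : Type*} [NormedField L] [IsAlgClosed L] {G : L[X]} {x : L}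
    {ε : ℝ} (hε : 0 < ε) (hG : G.eval x ≠ 0) (hG' : (derivative G).eval x ≠ 0)
    (h : ‖G.eval x‖ ≤ ε * ‖(derivative G).eval x‖) :
    ∃ β, G.IsRoot β ∧ ‖x - β‖ ≤ G.natDegree * ε := by
  have hG0 : G ≠ 0 := fun h0 => hG (by simp [h0])
  by_contra! hβ
  have hd : G.natDegree ≠ 0 := fun h0 => hG' (by rw [derivative_of_natDegree_zero h0, eval_zero])
  have hsplit := IsAlgClosed.splits G
  have hcard : G.roots.card = G.natDegree := hsplit.natDegree_eq_card_roots.symm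
  have hne : G.roots ≠ 0 := by
    rw [← Multiset.card_pos, hcard]; omega
  have hlt : ‖(G.roots.map fun z => 1 / (x - z)).sum‖ < ε⁻¹ := by
    refine (norm_multiset_sum_le _).trans_lt ?_
    rw [Multiset.map_map]
    refine (Multiset.sum_lt_sum_of_nonempty (g := fun _ => (G.natDegree * ε)⁻¹) hne
      fun z hz => ?_).trans_eq ?_
    · have hz' := hβ z (isRoot_of_mem_roots hz)
      rw [Function.comp_apply, norm_div, norm_one, one_div]
      exact inv_strictAnti₀ (by positivity) hz'
    · rw [Multiset.map_const', Multiset.sum_replicate, hcard, nsmul_eq_mul]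
      field_simp
  rw [hsplit.eval_derivative_eq_eval_mul_sum hG, norm_mul] at h
  have hpos := norm_pos_iff.mpr hG
  refine absurd h (not_le.mpr ?_)
  calc _ < ε * (‖G.eval x‖ * ε⁻¹) := by gcongr
    _ = _ := by field_simp

theorem eval_hasseDeriv_two_X_sub_C_mul {R : Type*} [CommRing R] (a : R) (G : R[X]) :
    (hasseDeriv 2 ((X - C a) * G)).eval a = (derivative G).eval a := by
  simp [hasseDeriv_mul, Finset.Nat.antidiagonal_succ, hasseDeriv_X, hasseDeriv_C]

theorem map_hasseDeriv {R S : Type*} [Semiring R] [Semiring S] (f : R →+* S) (k : ℕ) (P : R[X]) :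
    (hasseDeriv k P).map f = hasseDeriv k (P.map f) := by
  ext i
  simp [hasseDeriv_coeff]

section Roots

variable {p : ℕ} [Fact p.Prime]

theorem norm_aeval_intCast (P : ℤ[X]) (x : ℤ) :
    ‖aeval (x : ℤ_[p]) P‖ = ‖((P.eval x : ℤ) : ℤ_[p])‖ := by
  rw [← eq_intCast (algebraMap ℤ ℤ_[p]) x, ← eq_intCast (algebraMap ℤ ℤ_[p]),
    aeval_algebraMap_apply_eq_algebraMap_eval]

theorem exists_close_roots {L : Type*} [NormedField L] [Algebra ℚ_[p] L] [IsAlgClosed L]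
    (hL : ∀ y : ℚ_[p], ‖algebraMap ℚ_[p] L y‖ = ‖y‖) {P : ℤ[X]} {x : ℤ} {k : ℕ}
    (h0 : (p : ℤ) ^ (2 * k + 1) ∣ P.eval x) (h1 : (p : ℤ) ^ k ∣ (derivative P).eval x)
    (h1' : ¬ (p : ℤ) ^ (k + 1) ∣ (derivative P).eval x)
    (h2 : ¬ (p : ℤ) ∣ (hasseDeriv 2 P).eval x) :
    ∃ α : ℤ_[p], aeval α P = 0 ∧ ‖α - (x : ℤ_[p])‖ < (p : ℝ) ^ (-k : ℤ) ∧
      ∃ β : L, aeval β P = 0 ∧ β ≠ algebraMap ℚ_[p] L (α : ℚ_[p]) ∧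
        ‖algebraMap ℚ_[p] L (α : ℚ_[p]) - β‖ ≤ P.natDegree * (p : ℝ) ^ (-k : ℤ) := by
  have hp : 1 < (p : ℝ) := mod_cast (Fact.out : p.Prime).one_lt
  rw [← PadicInt.norm_int_le_pow_iff_dvd, ← norm_aeval_intCast] at h0 h1 h1'
  rw [← PadicInt.norm_int_lt_one_iff_dvd, ← norm_aeval_intCast] at h2
  have hd : ‖aeval (x : ℤ_[p]) (derivative P)‖ = (p : ℝ) ^ (-k : ℤ) := by
    refine le_antisymm h1 ?_
    rw [PadicInt.norm_le_pow_iff_norm_lt_pow_add_one, not_lt] at h1'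
    simpa using h1'
  obtain ⟨α, hα0, hαx, hαd, -⟩ := hensels_lemma (F := P) (a := (x : ℤ_[p])) (by
    rw [hd]
    refine h0.trans_lt ?_
    rw [← zpow_natCast, ← zpow_mul]
    exact zpow_lt_zpow_right₀ hp (by push_cast; omega))
  rw [hd] at hαx hαd
  refine ⟨α, hα0, hαx, ?_⟩
  have hh : ‖aeval α (hasseDeriv 2 P)‖ = 1 := by
    refine le_antisymm (PadicInt.norm_le_one _) (not_lt.mp fun hlt => h2 ?_)
    have hdvd := sub_dvd_eval_sub α (x : ℤ_[p]) ((hasseDeriv 2 P).map (algebraMap ℤ ℤ_[p]))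
    rw [eval_map_algebraMap, eval_map_algebraMap] at hdvd
    obtain ⟨c, hc⟩ := hdvd
    have hsub : ‖aeval α (hasseDeriv 2 P) - aeval (x : ℤ_[p]) (hasseDeriv 2 P)‖ < 1 := by
      rw [hc, norm_mul]
      refine (mul_le_of_le_one_right (norm_nonneg _) (PadicInt.norm_le_one c)).trans_lt ?_
      exact hαx.trans_le (zpow_le_one_of_nonpos₀ hp.le (by omega))
    have := PadicInt.nonarchimedean (aeval α (hasseDeriv 2 P))
      (-(aeval α (hasseDeriv 2 P) - aeval (x : ℤ_[p]) (hasseDeriv 2 P)))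
    rw [neg_sub, add_sub_cancel, norm_sub_rev] at this
    exact this.trans_lt (max_lt hlt hsub)
  set F := P.map (algebraMap ℤ ℤ_[p]) with hF
  obtain ⟨G, hG⟩ := dvd_iff_isRoot.mpr (show F.IsRoot α by rw [IsRoot, eval_map_algebraMap, hα0])
  have hG1 : ‖G.eval α‖ = (p : ℝ) ^ (-k : ℤ) := by
    rw [← hαd, ← eval_map_algebraMap, ← derivative_map, ← hF, hG]
    simp
  have hG2 : ‖(derivative G).eval α‖ = 1 := by
    rw [← hh, ← eval_map_algebraMap, map_hasseDeriv, ← hF, hG, eval_hasseDeriv_two_X_sub_C_mul]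
  let ι : ℤ_[p] →+* L := (algebraMap ℚ_[p] L).comp PadicInt.Coe.ringHom
  have hι : ∀ y, ‖ι y‖ = ‖y‖ := fun y => hL y
  have hPL : P.map (algebraMap ℤ L) = (X - C (ι α)) * G.map ι := by
    have : algebraMap ℤ L = ι.comp (algebraMap ℤ ℤ_[p]) := RingHom.ext_int _ _
    rw [this, ← map_map, ← hF, hG]
    simp
  have hGL : (G.map ι).eval (ι α) = ι (G.eval α) := by rw [eval_map_apply]
  have hGL' : (derivative (G.map ι)).eval (ι α) = ι ((derivative G).eval α) := by
    rw [derivative_map, eval_map_apply]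
  have hpk : 0 < (p : ℝ) ^ (-k : ℤ) := by positivity
  have hGne : (G.map ι).eval (ι α) ≠ 0 := by
    rw [← norm_pos_iff, hGL, hι, hG1]; exact hpk
  obtain ⟨β, hβ, hle⟩ := exists_root_norm_sub_le (G := G.map ι) (x := ι α) hpk hGne
    (by rw [← norm_pos_iff, hGL', hι, hG2]; exact one_pos)
    (by rw [hGL, hGL', hι, hι, hG1, hG2, mul_one])
  refine ⟨β, ?_, fun h => hGne ?_, hle.trans ?_⟩
  · rw [← eval_map_algebraMap, hPL, eval_mul, hβ.eq_zero, mul_zero]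
  · rw [← hβ.eq_zero, h]; rfl
  · have hdeg : (G.map ι).natDegree ≤ P.natDegree := by
      refine (natDegree_le_of_dvd ⟨X - C (ι α), by rw [hPL, mul_comm]⟩ ?_).trans natDegree_map_le
      rw [hPL]
      exact mul_ne_zero (X_sub_C_ne_zero _) fun h0 => hGne (by simp [h0])
    gcongr

end Roots

theorem natAbs_coeff_le_polyHeight (P : ℤ[X]) (i : ℕ) : (P.coeff i).natAbs ≤ polyHeight P := by
  rcases le_or_gt i P.natDegree with hi | hi
  · exact Finset.le_sup (f := fun i => (P.coeff i).natAbs) (Finset.mem_range_succ_iff.mpr hi)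
  · simp [coeff_eq_zero_of_natDegree_lt hi]

theorem polyHeight_eq_norm {P : ℤ[X]} {N : ℕ} (hP : P.natDegree < N) :
    (polyHeight P : ℝ) = ‖fun a : Fin N => P.coeff a‖ := by
  have hnorm : ∀ z : ℤ, ‖z‖ = (z.natAbs : ℝ) := fun z => by rw [Int.norm_eq_abs, Nat.cast_natAbs,
    Int.cast_abs]
  refine le_antisymm ?_ ((pi_norm_le_iff_of_nonneg (Nat.cast_nonneg _)).mpr fun i => ?_)
  · obtain ⟨i, hi, h⟩ := Finset.exists_mem_eq_sup (Finset.range (P.natDegree + 1))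
      (by simp) fun i => (P.coeff i).natAbs
    rw [polyHeight, h, ← hnorm]
    exact norm_le_pi_norm (fun a : Fin N => P.coeff a)
      ⟨i, (Finset.mem_range_succ_iff.mp hi).trans_lt hP⟩
  · rw [hnorm]
    exact_mod_cast natAbs_coeff_le_polyHeight P i

theorem irreducible_primPart_of_eisenstein {P : ℤ[X]} {q : ℕ} (hq : q.Prime)
    (hn : 0 < P.natDegree) (hlead : ¬ (q : ℤ) ∣ P.coeff P.natDegree)
    (hlow : ∀ i < P.natDegree, (q : ℤ) ∣ P.coeff i) (h0 : ¬ (q : ℤ) ^ 2 ∣ P.coeff 0) :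
    Irreducible P.primPart := by
  have hq' : Prime (q : ℤ) := Nat.prime_iff_prime_int.mp hq
  have hcoeff : ∀ i, P.coeff i = P.content * P.primPart.coeff i := fun i => by
    conv_lhs => rw [P.eq_C_content_mul_primPart]
    rw [coeff_C_mul]
  have hc : ¬ (q : ℤ) ∣ P.content := fun h => hlead (by rw [hcoeff]; exact h.mul_right _)
  refine irreducible_of_eisenstein_criterion (P := Ideal.span {(q : ℤ)})
    ((Ideal.span_singleton_prime hq'.ne_zero).mpr hq') ?_ (fun i hi => ?_) ?_ ?_
    P.isPrimitive_primPart
  · rw [Ideal.mem_span_singleton, leadingCoeff, natDegree_primPart]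
    exact fun h => hlead (by rw [hcoeff]; exact h.mul_left _)
  · rw [Ideal.mem_span_singleton]
    rw [coe_lt_degree, natDegree_primPart] at hi
    have := hlow i hi
    rw [hcoeff] at this
    exact (hq'.dvd_or_dvd this).resolve_left hc
  · rw [← natDegree_pos_iff_degree_pos, natDegree_primPart]
    exact hn
  · rw [Ideal.span_singleton_pow, Ideal.mem_span_singleton]
    exact fun h => h0 (by rw [hcoeff]; exact h.mul_left _)

theorem polyHeight_primPart_le {P : ℤ[X]} (hP : P ≠ 0) : polyHeight P.primPart ≤ polyHeight P := by
  refine Finset.sup_le fun i _ => le_trans ?_ (natAbs_coeff_le_polyHeight P i)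
  conv_rhs => rw [P.eq_C_content_mul_primPart]
  rw [coeff_C_mul, Int.natAbs_mul]
  exact Nat.le_mul_of_pos_left _ (Int.natAbs_pos.mpr (content_eq_zero_iff.not.mpr hP))

/-- An integer polynomial which satisfies the Eisenstein conditions at `q`, and nearly has a double
root at `x` modulo powers of `p`. -/
theorem exists_eisenstein_isClose {p k n q : ℕ} [Fact p.Prime] (hn : 2 ≤ n) (hq : q.Prime)
    (hqp : p ≠ q) {δ T : ℝ} (hδ : 0 < δ) (hT : 1 ≤ T) (hTN : T ^ (n + 1) = (p : ℝ) ^ (3 * k)) {x : ℤ}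
    (hx : ∀ v : Fin (n + 1) → ℤ, v ≠ 0 → IsClose p k x v → δ * T ≤ ‖v‖) :
    ∃ P R : ℤ[X], P = X ^ n + C (q : ℤ) + C ((q : ℤ) ^ 2) * R ∧ P.natDegree = n ∧
      (polyHeight P : ℝ) ≤
        (q ^ 2 * p : ℕ) * ((n + 1 : ℕ) * (((n + 1 : ℕ) / δ + 1) ^ (n + 1) * T)) ∧
      (p : ℤ) ^ (2 * k + 1) ∣ P.eval x ∧ (p : ℤ) ^ k ∣ (derivative P).eval x ∧
      ¬ (p : ℤ) ^ (k + 1) ∣ (derivative P).eval x ∧ ¬ (p : ℤ) ∣ (hasseDeriv 2 P).eval x := by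
  have hp : p.Prime := Fact.out
  have hpZ : Prime (p : ℤ) := Nat.prime_iff_prime_int.mp hp
  have hcop : IsCoprime ((p : ℤ) ^ (2 * k + 1)) ((q : ℤ) ^ 2) :=
    (Nat.isCoprime_iff_coprime.mpr ((Nat.coprime_primes hp hq).mpr hqp)).pow
  obtain ⟨u, v, huv⟩ := hcop
  have hvq : ¬ (p : ℤ) ∣ v * (q : ℤ) ^ 2 := fun h => hpZ.not_dvd_one (by
    rw [← huv]
    exact dvd_add ((dvd_pow_self _ (by omega)).mul_left _) h)
  set A : ℤ[X] := (X - C x) * (X - C x + C ((p : ℤ) ^ k)) with hA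
  set B : ℤ[X] := X ^ n + C (q : ℤ) with hB
  set S : ℤ[X] := C (v * (q : ℤ) ^ 2) * A + C (u * (p : ℤ) ^ (2 * k + 1)) * B with hS
  have hAdeg : A.natDegree ≤ n := by
    refine le_trans ?_ hn
    rw [hA]
    compute_degree
  have hBdeg : B.natDegree ≤ n := by rw [hB]; compute_degree
  have hSdeg : S.natDegree ≤ n := natDegree_add_le_of_degree_le
    ((natDegree_C_mul_le _ _).trans hAdeg) ((natDegree_C_mul_le _ _).trans hBdeg)
  obtain ⟨w, hw, hwS⟩ := exists_isClose_norm_sub_le (by omega) hδ hT hTN hx (q ^ 2 * p)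
    (Nat.mul_pos (pow_pos hq.pos 2) hp.pos) fun a => S.coeff a
  set V := polyOfCoeffs w with hV
  have hVdeg : V.natDegree ≤ n := natDegree_polyOfCoeffs_le w
  rw [isClose_iff (by omega), ← hV] at hw
  obtain ⟨⟨c₀, hc₀⟩, c₁, hc₁⟩ := hw
  set m : ℤ := (q : ℤ) ^ 2 * p with hm
  set P : ℤ[X] := S - C m * V with hP
  set R : ℤ[X] := C v * A - C (p : ℤ) * V - C v * B with hR
  have hPR : P = B + C ((q : ℤ) ^ 2) * R := by
    have : u * (p : ℤ) ^ (2 * k + 1) = 1 - v * (q : ℤ) ^ 2 := by linear_combination huv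
    rw [hP, hS, this, hm, hR]
    simp only [C_mul, C_sub, C_1]
    ring
  have hPle : P.natDegree ≤ n :=
    natDegree_sub_le_of_le hSdeg ((natDegree_C_mul_le _ _).trans hVdeg) |>.trans (by simp)
  have hPn : P.natDegree = n := by
    refine natDegree_eq_of_le_of_coeff_ne_zero hPle fun h0 => ?_
    have hBn : B.coeff n = 1 := by simp [hB, show n ≠ 0 by omega]
    rw [hPR, coeff_add, coeff_C_mul, hBn] at h0
    have : (q : ℤ) ∣ 1 := ⟨-(q * R.coeff n), by linear_combination h0⟩
    exact (Nat.prime_iff_prime_int.mp hq).not_dvd_one this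
  have hA0 : A.eval x = 0 := by simp [hA]
  have hA1 : (derivative A).eval x = (p : ℤ) ^ k := by
    rw [hA, derivative_mul, derivative_add, derivative_C]
    simp
  have hA2 : (hasseDeriv 2 A).eval x = 1 := by
    rw [hA, eval_hasseDeriv_two_X_sub_C_mul, derivative_add, derivative_C]
    simp
  have hP1 : (derivative P).eval x = (p : ℤ) ^ k * (v * (q : ℤ) ^ 2) +
      (p : ℤ) ^ (k + 1) * (u * p ^ k * (derivative B).eval x - (q : ℤ) ^ 2 * c₁) := by
    simp only [hP, hS, derivative_sub, derivative_add, derivative_C_mul, eval_sub, eval_add,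
      eval_mul, eval_C, hA1, hc₁, hm]
    ring
  refine ⟨P, R, hPR, hPn, ?_, ⟨u * B.eval x - (q : ℤ) ^ 2 * c₀, ?_⟩, ?_, ?_, fun h => ?_⟩
  · rw [polyHeight_eq_norm (show P.natDegree < n + 1 by omega)]
    convert hwS using 2
    ext a
    rw [hP, coeff_sub, coeff_C_mul, hV, coeff_polyOfCoeffs, hm]
    simp
  · simp only [hP, hS, eval_sub, eval_add, eval_mul, eval_C, hA0, hc₀, hm]
    ring
  · rw [hP1]
    exact dvd_add (dvd_mul_right _ _) ((pow_dvd_pow _ k.le_succ).mul_right _)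
  · rw [hP1, dvd_add_left (dvd_mul_right _ _), pow_succ]
    exact fun h => hvq (Int.dvd_of_mul_dvd_mul_left (pow_ne_zero k hpZ.ne_zero) h)
  · refine hvq ?_
    have : (hasseDeriv 2 P).eval x = v * (q : ℤ) ^ 2 + p *
        (u * p ^ (2 * k) * (hasseDeriv 2 B).eval x - (q : ℤ) ^ 2 * (hasseDeriv 2 V).eval x) := by
      simp only [hP, hS, ← smul_eq_C_mul, map_sub, map_add, map_smul, eval_sub, eval_add,
        eval_smul, hA2, hm, smul_eq_mul]
      ring
    rw [this] at h
    exact (dvd_add_left (dvd_mul_right _ _)).mp h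

theorem exists_irreducible_isClose {p k n q : ℕ} [Fact p.Prime] (hn : 2 ≤ n) (hq : q.Prime)
    (hqp : p ≠ q) {δ T : ℝ} (hδ : 0 < δ) (hT : 1 ≤ T) (hTN : T ^ (n + 1) = (p : ℝ) ^ (3 * k)) {x : ℤ}
    (hx : ∀ v : Fin (n + 1) → ℤ, v ≠ 0 → IsClose p k x v → δ * T ≤ ‖v‖) :
    ∃ P : ℤ[X], Irreducible P ∧ P.natDegree = n ∧ δ * T ≤ polyHeight P ∧
      (polyHeight P : ℝ) ≤
        (q ^ 2 * p : ℕ) * ((n + 1 : ℕ) * (((n + 1 : ℕ) / δ + 1) ^ (n + 1) * T)) ∧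
      (p : ℤ) ^ (2 * k + 1) ∣ P.eval x ∧ (p : ℤ) ^ k ∣ (derivative P).eval x ∧
      ¬ (p : ℤ) ^ (k + 1) ∣ (derivative P).eval x ∧ ¬ (p : ℤ) ∣ (hasseDeriv 2 P).eval x := by
  obtain ⟨P, R, hPR, hPn, hPh, h0, h1, h1', h2⟩ := exists_eisenstein_isClose hn hq hqp hδ hT hTN hx
  have hqZ := Nat.prime_iff_prime_int.mp hq
  have hpZ : Prime (p : ℤ) := Nat.prime_iff_prime_int.mp Fact.out
  have hP0 : P ≠ 0 := fun h => by rw [h, natDegree_zero] at hPn; omega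
  have hirr : Irreducible P.primPart := by
    refine irreducible_primPart_of_eisenstein hq (by omega) ?_ (fun i hi => ?_) ?_
    · rw [hPn, hPR, coeff_add, coeff_C_mul, dvd_add_left ((dvd_pow_self _ two_ne_zero).mul_right _)]
      simpa [coeff_C, show n ≠ 0 by omega] using hqZ.not_dvd_one
    · rw [hPn] at hi
      rw [hPR, coeff_add, coeff_C_mul]
      refine dvd_add ?_ ((dvd_pow_self _ two_ne_zero).mul_right _)
      rw [coeff_add, coeff_X_pow, if_neg (by omega), zero_add, coeff_C]
      split_ifs <;> simp
    · rw [hPR, coeff_add, coeff_C_mul, dvd_add_left (dvd_mul_right _ _), coeff_add, coeff_X_pow,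
        if_neg (by omega), zero_add, coeff_C_zero]
      intro h
      have := Int.le_of_dvd (by exact_mod_cast hq.pos) h
      have := hq.two_le
      nlinarith
  have hPc := P.eq_C_content_mul_primPart
  set c := P.content
  set P₀ := P.primPart
  have e0 : P.eval x = c * P₀.eval x := by rw [hPc]; simp
  have e1 : (derivative P).eval x = c * (derivative P₀).eval x := by rw [hPc]; simp
  have e2 : (hasseDeriv 2 P).eval x = c * (hasseDeriv 2 P₀).eval x := by
    rw [hPc, ← smul_eq_C_mul, map_smul, eval_smul, smul_eq_mul]
  rw [e0] at h0
  rw [e1] at h1 h1'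
  rw [e2] at h2
  have hc : IsCoprime (p : ℤ) c :=
    (Prime.coprime_iff_not_dvd hpZ).mpr fun h => h2 (h.mul_right _)
  have h0' := hc.pow_left.dvd_of_dvd_mul_left h0
  have h₁ := hc.pow_left.dvd_of_dvd_mul_left h1
  have hdeg : P₀.natDegree = n := by rw [natDegree_primPart, hPn]
  refine ⟨P₀, hirr, hdeg, ?_,
    le_trans (by exact_mod_cast polyHeight_primPart_le hP0) hPh, h0', h₁,
    fun h => h1' (h.mul_left _), fun h => h2 (h.mul_left _)⟩
  rw [polyHeight_eq_norm (show P₀.natDegree < n + 1 by omega)]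
  have hpoly := polyOfCoeffs_coeff (show P₀.natDegree < n + 1 by omega)
  refine hx _ (fun h => hirr.ne_zero ?_) ?_
  · rw [← hpoly, h, polyOfCoeffs_eq_zero]
  · rw [isClose_iff (by omega), hpoly]
    exact ⟨(pow_dvd_pow _ (by omega)).trans h0', h₁⟩

theorem finite_setOf_aeval_eq_zero (p : ℕ) [Fact p.Prime] (n M : ℕ) :
    {α : ℤ_[p] | ∃ P : ℤ[X], P ≠ 0 ∧ P.natDegree ≤ n ∧ polyHeight P ≤ M ∧ aeval α P = 0}.Finite := by
  classical
  refine (bUnion_roots_finite (algebraMap ℤ ℤ_[p]) n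
    (Set.finite_Icc (-(M : ℤ)) M)).subset ?_
  rintro α ⟨P, hP, hdeg, hM, hα⟩
  refine Set.mem_biUnion (x := P) ⟨hdeg, fun i => ?_⟩ ?_
  · have := (natAbs_coeff_le_polyHeight P i).trans hM
    rw [Set.mem_Icc]
    omega
  · rw [Finset.mem_coe, Multiset.mem_toFinset,
      mem_roots ((Polynomial.map_ne_zero_iff (RingHom.injective_int _)).mpr hP), IsRoot,
      eval_map_algebraMap, hα]

theorem exists_scale {p n : ℕ} (hp : 1 < p) (hn : 2 ≤ n) {Q : ℝ} (hQ : 1 ≤ Q) :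
    ∃ (k : ℕ) (T : ℝ), 1 ≤ T ∧ T ^ (n + 1) = (p : ℝ) ^ (3 * k) ∧ T ≤ Q ∧ Q ≤ p * T ∧
      Q ^ (((n : ℝ) + 1) / 3) ≤ (p : ℝ) ^ (k + 1) := by
  have hp1 : 1 < (p : ℝ) := mod_cast hp
  have hn0 : (0 : ℝ) < n + 1 := by positivity
  have hn2 : (2 : ℝ) ≤ n := mod_cast hn
  have hQ0 : 0 ≤ Q := by linarith
  obtain ⟨k, hk, hk'⟩ := exists_nat_pow_near
    (Real.one_le_rpow hQ (z := ((n : ℝ) + 1) / 3) (by positivity)) hp1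
  have hinv : (Q ^ (((n : ℝ) + 1) / 3)) ^ (3 / ((n : ℝ) + 1)) = Q := by
    rw [← Real.rpow_mul hQ0, show ((n : ℝ) + 1) / 3 * (3 / ((n : ℝ) + 1)) = 1 by field_simp,
      Real.rpow_one]
  refine ⟨k, ((p : ℝ) ^ k) ^ (3 / ((n : ℝ) + 1)),
    Real.one_le_rpow (one_le_pow₀ hp1.le) (by positivity), ?_, ?_, ?_, hk'.le⟩
  · rw [← Real.rpow_natCast, ← Real.rpow_mul (by positivity), Nat.cast_add_one,
      div_mul_cancel₀ _ hn0.ne', mul_comm 3 k, pow_mul]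
    norm_cast
  · calc _ ≤ (Q ^ (((n : ℝ) + 1) / 3)) ^ (3 / ((n : ℝ) + 1)) := by gcongr
      _ = Q := hinv
  · calc Q = (Q ^ (((n : ℝ) + 1) / 3)) ^ (3 / ((n : ℝ) + 1)) := hinv.symm
      _ ≤ ((p : ℝ) * p ^ k) ^ (3 / ((n : ℝ) + 1)) := by
        rw [← pow_succ']
        gcongr
      _ = (p : ℝ) ^ (3 / ((n : ℝ) + 1)) * ((p : ℝ) ^ k) ^ (3 / ((n : ℝ) + 1)) :=
        Real.mul_rpow (by positivity) (by positivity)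
      _ ≤ (p : ℝ) ^ (1 : ℝ) * ((p : ℝ) ^ k) ^ (3 / ((n : ℝ) + 1)) := by
        gcongr
        · exact hp1.le
        · rw [div_le_one hn0]
          linarith
      _ = _ := by rw [Real.rpow_one]

/-- Let `n ≥ 2` and `p` be a prime. Then there are constants
`c₁, c₂, c₃, c₄ > 0` depending only on `n` and `p` such that for all sufficiently large `Q`
there are at least `c₁ Q^{(n+1)/3}` elements `α ∈ ℤ_p` which are roots of an irreducible
`P ∈ ℤ[X]` of degree `n` with `c₂ Q ≤ H(P) ≤ c₃ Q` having another root `β ≠ α` in the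
algebraic closure of `ℚ_p` with `0 < |α − β|_p ≤ c₄ Q^{−(n+1)/3}`.

The algebraic closure of `ℚ_p` together with its (unique) extension of the `p`-adic absolute
value is modelled by an algebraically closed normed field `L`, algebraic over `ℚ_p`, whose
norm restricts to the `p`-adic norm on `ℚ_p`. -/
theorem stmt3 (p : ℕ) [Fact p.Prime] (n : ℕ) (hn : 2 ≤ n)
    (L : Type*) [NormedField L] [Algebra ℚ_[p] L] [IsAlgClosed L]
    [Algebra.IsAlgebraic ℚ_[p] L]
    (hL : ∀ y : ℚ_[p], ‖algebraMap ℚ_[p] L y‖ = ‖y‖) :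
    ∃ c₁ c₂ c₃ c₄ : ℝ, 0 < c₁ ∧ 0 < c₂ ∧ 0 < c₃ ∧ 0 < c₄ ∧
      ∃ Q₀ : ℝ, ∀ Q : ℝ, Q₀ ≤ Q →
        c₁ * Q ^ (((n : ℝ) + 1) / 3) ≤
          ({α : ℤ_[p] | ∃ P : Polynomial ℤ, Irreducible P ∧ P.natDegree = n ∧
              Polynomial.aeval α P = 0 ∧
              c₂ * Q ≤ (polyHeight P : ℝ) ∧ (polyHeight P : ℝ) ≤ c₃ * Q ∧
              ∃ β : L, Polynomial.aeval β P = 0 ∧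
                β ≠ algebraMap ℚ_[p] L (α : ℚ_[p]) ∧
                ‖algebraMap ℚ_[p] L (α : ℚ_[p]) - β‖ ≤
                  c₄ * Q ^ (-(((n : ℝ) + 1) / 3))}.ncard : ℝ) := by
  classical
  have hp : p.Prime := Fact.out
  have hp0 : 0 < (p : ℝ) := mod_cast hp.pos
  have hn0 : 0 < (n : ℝ) := by positivity
  obtain ⟨q, hqp, hq⟩ := Nat.exists_infinite_primes (p + 1)
  have hq0 : 0 < (q : ℝ) := mod_cast hq.pos
  obtain ⟨δ, hδ, hcard⟩ := exists_pos_half_le_card p (N := n + 1) (by omega)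
  set D : ℝ := (q ^ 2 * p : ℕ) * ((n + 1 : ℕ) * ((n + 1 : ℕ) / δ + 1) ^ (n + 1)) with hD
  have hD0 : 0 < D := by
    rw [hD]
    push_cast
    positivity
  refine ⟨1 / (2 * p), δ / p, D, n * p, by positivity, by positivity, hD0, by positivity, 1,
    fun Q hQ => ?_⟩
  obtain ⟨k, T, hT, hTN, hTQ, hQT, hQk⟩ := exists_scale hp.one_lt hn hQ
  set S := {α : ℤ_[p] | ∃ P : Polynomial ℤ, Irreducible P ∧ P.natDegree = n ∧
              Polynomial.aeval α P = 0 ∧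
              δ / p * Q ≤ (polyHeight P : ℝ) ∧ (polyHeight P : ℝ) ≤ D * Q ∧
              ∃ β : L, Polynomial.aeval β P = 0 ∧
                β ≠ algebraMap ℚ_[p] L (α : ℚ_[p]) ∧
                ‖algebraMap ℚ_[p] L (α : ℚ_[p]) - β‖ ≤
                  n * p * Q ^ (-(((n : ℝ) + 1) / 3))} with hS
  have hSfin : S.Finite := by
    refine (finite_setOf_aeval_eq_zero p n ⌊D * Q⌋₊).subset ?_
    rintro α ⟨P, hP, hdeg, hα, -, hM, -⟩
    exact ⟨P, hP.ne_zero, hdeg.le, Nat.le_floor hM, hα⟩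
  have hβ : (p : ℝ) ^ (-k : ℤ) ≤ p * Q ^ (-(((n : ℝ) + 1) / 3)) := by
    rw [Real.rpow_neg (by linarith), zpow_neg, zpow_natCast, ← div_eq_mul_inv,
      le_div_iff₀ (Real.rpow_pos_of_pos (by linarith) _), inv_mul_le_iff₀ (by positivity),
      ← pow_succ]
    exact hQk
  have hα : ∀ a ∈ (Finset.range (p ^ k)).filter (fun a => ∃ x : ℕ, x % p ^ k = a ∧
      ∀ v : Fin (n + 1) → ℤ, v ≠ 0 → IsClose p k x v → δ * T ≤ ‖v‖),
      ∃ α ∈ S, ∃ x : ℕ, x % p ^ k = a ∧ ‖α - ((x : ℤ) : ℤ_[p])‖ < (p : ℝ) ^ (-k : ℤ) := by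
    intro a ha
    obtain ⟨-, x, hxa, hx⟩ := Finset.mem_filter.mp ha
    obtain ⟨P, hirr, hdeg, hlow, hupp, h0, h1, h1', h2⟩ :=
      exists_irreducible_isClose hn hq (by omega) hδ hT hTN hx
    obtain ⟨α, hα0, hαx, β, hβ0, hβα, hle⟩ := exists_close_roots hL h0 h1 h1' h2
    refine ⟨α, ⟨P, hirr, hdeg, hα0, ?_, ?_, β, hβ0, hβα, ?_⟩, x, hxa, hαx⟩
    · refine le_trans ?_ hlow
      rw [div_mul_eq_mul_div, div_le_iff₀ hp0]
      calc δ * Q ≤ δ * (p * T) := by gcongr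
        _ = _ := by ring
    · calc (polyHeight P : ℝ) ≤ D * T := hupp.trans_eq (by rw [hD]; ring)
        _ ≤ D * Q := by gcongr
    · rw [hdeg] at hle
      rw [mul_assoc]
      exact hle.trans (by gcongr)
  choose! f hfS x hxa hfx using hα
  have hle := Finset.card_le_card_of_injOn f (t := hSfin.toFinset)
    (fun a ha => (hSfin.mem_toFinset).mpr (hfS a ha)) fun a ha a' ha' haa' => by
      have h1 := hfx a ha
      have h2 := hfx a' ha'
      rw [← haa'] at h2
      have h3 : ‖(((x a : ℤ) - (x a' : ℤ) : ℤ) : ℤ_[p])‖ ≤ (p : ℝ) ^ (-k : ℤ) := by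
        have := PadicInt.nonarchimedean (f a - ((x a' : ℤ) : ℤ_[p]))
          (-(f a - ((x a : ℤ) : ℤ_[p])))
        rw [norm_neg] at this
        rw [Int.cast_sub]
        refine le_trans (le_of_eq ?_) (this.trans (max_le h2.le h1.le))
        congr 1
        ring
      rw [PadicInt.norm_int_le_pow_iff_dvd] at h3
      rw [← hxa a ha, ← hxa a' ha']
      exact ((Nat.modEq_iff_dvd).mpr (by exact_mod_cast h3)).symm
  rw [← Set.ncard_eq_toFinset_card S hSfin] at hle
  have hhalf := hcard k T hT hTN
  have hle' : ((Finset.card _ : ℕ) : ℝ) ≤ S.ncard := Nat.cast_le.mpr hle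
  calc 1 / (2 * p) * Q ^ (((n : ℝ) + 1) / 3) ≤ 1 / (2 * p) * (p : ℝ) ^ (k + 1) := by gcongr
    _ = (p : ℝ) ^ k / 2 := by rw [pow_succ]; field_simp
    _ ≤ S.ncard := by
      rw [div_le_iff₀ two_pos, mul_comm]
      refine hhalf.trans ?_
      gcongr
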